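/- arXiv:1210.2679 — 2 statements merged into one kernel-verified Lean document; each statement's English description precedes it below -/
import Mathlib

section
/- Let G be a finite group, w ≥ 0, let 𝒳 be a finitely generated subgroup of the abelian group CF(G) of ℚ-valued class functions on G, and let B be a ℤ-basis of 𝒳. Then the class functions ζ_{λ̲}, as λ̲ runs over PMap_w(B), form a ℤ-basis of 𝒳≀S_w. -/
open scoped BigOperators
open Classical

noncomputable section

/-- The number of maps `f` from the (indexed) parts of `mu` to the parts of `lam` such that for
every part `lam_i` of `lam`, the sum of the parts of `mu` in the fibre `f⁻¹(i)` equals `lam_i`.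
This is `|𝓜_{λμ}|` and also the value of the permutation character `h_λ` on the class of cycle
type `μ`. -/
def Mcount (lam mu : Multiset ℕ) : ℕ :=
  Fintype.card {f : Fin (Multiset.card mu) → Fin (Multiset.card lam) //
    ∀ i : Fin (Multiset.card lam),
      (∑ j ∈ Finset.univ.filter (fun j => f j = i), (mu.sort (· ≤ ·)).getD j 0)
        = (lam.sort (· ≤ ·)).getD i 0}

/-- `z_λ = ∏_i i^{m_i(λ)} m_i(λ)!`. -/
def zMult (lam : Multiset ℕ) : ℕ :=
  ∏ i ∈ lam.toFinset, i ^ lam.count i * (lam.count i).factorial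

/-- The cycle type of a permutation of `Fin n`, as the multiset of parts of a partition of `n`
(including the parts equal to `1` corresponding to fixed points). -/
def cycM {n : ℕ} (g : Equiv.Perm (Fin n)) : Multiset ℕ :=
  g.cycleType + Multiset.replicate (n - g.support.card) 1

/-- The value of the irreducible character `s_λ` of the symmetric group on the conjugacy class
of cycle type `nu`, given by the Jacobi–Trudi determinant `s_λ = det(h_{λ_i - i + j})_{i,j}`,
where `h_α` has value `Mcount α ν` on the class of cycle type `ν`. -/
def sval (lam nu : Multiset ℕ) : ℚ :=
  let L := (lam.sort (· ≤ ·)).reverse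
  let l := Multiset.card lam
  ∑ σ : Equiv.Perm (Fin l),
    ((Equiv.Perm.sign σ : ℤ) : ℚ) *
      (if ∀ i : Fin l, (i : ℕ) ≤ L.getD i 0 + (σ i : ℕ) then
        (Mcount ((Multiset.map (fun i : Fin l => L.getD i 0 + (σ i : ℕ) - (i : ℕ))
            (Finset.univ.val : Multiset (Fin l))).filter (fun x => x ≠ 0)) nu : ℚ)
       else 0)

/-- The irreducible character of `S_n` labelled by the partition `lam`, as a class function on
the symmetric group `S_n = Perm (Fin n)`. -/
def sFun {n : ℕ} (lam : Nat.Partition n) : Equiv.Perm (Fin n) → ℚ :=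
  fun g => sval lam.parts (cycM g)

/-- The usual scalar product of class functions on a finite group:
`⟨f, h⟩ = |G|⁻¹ ∑_{g ∈ G} f(g) h(g⁻¹)`. -/
def sp {G : Type*} [Group G] [Fintype G] (f h : G → ℚ) : ℚ :=
  (Fintype.card G : ℚ)⁻¹ * ∑ g : G, f g * h g⁻¹

/-- The induced class function along an injection `ι : H → G` (underlying a subgroup inclusion):
`Ind φ (g) = |H|⁻¹ ∑_{x ∈ G} ∑_{h ∈ H, ι(h) = x g x⁻¹} φ(h)`. -/
def IndFun {H G : Type*} [Fintype H] [Fintype G] [Group G] (ι : H → G) (φ : H → ℚ) :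
    G → ℚ :=
  fun g => (Fintype.card H : ℚ)⁻¹ * ∑ x : G, ∑ h : H, if ι h = x * g * x⁻¹ then φ h else 0

/-- A bijection `Σ_i Fin (w_i) ≃ Fin w` when `∑_i w_i = w`, realising `Fin w` as the disjoint
union of blocks of sizes `w_i`. -/
def embSigma {η : Type*} [Fintype η] (ws : η → ℕ) {w : ℕ} (h : ∑ i, ws i = w) :
    (Σ i, Fin (ws i)) ≃ Fin w :=
  Fintype.equivOfCardEq (by simp [h])

/-- The wreath product `G ≀ S_w`: pairs `(x; σ)` with `x : Fin w → G`, `σ ∈ S_w`, and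
multiplication `(x; σ)(y; τ) = (i ↦ x_i y_{σ⁻¹(i)}; στ)`. -/
def Wr (G : Type*) (w : ℕ) : Type _ := (Fin w → G) × Equiv.Perm (Fin w)

instance (G : Type*) [Fintype G] (w : ℕ) : Fintype (Wr G w) :=
  inferInstanceAs (Fintype ((Fin w → G) × Equiv.Perm (Fin w)))

section WrGroup

variable {G : Type*} [Group G] {w : ℕ}

instance : Mul (Wr G w) := ⟨fun a b => (fun i => a.1 i * b.1 (a.2⁻¹ i), a.2 * b.2)⟩
instance : One (Wr G w) := ⟨((fun _ => 1), 1)⟩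
instance : Inv (Wr G w) := ⟨fun a => (fun i => (a.1 (a.2 i))⁻¹, a.2⁻¹)⟩

instance : Group (Wr G w) :=
  Group.ofLeftAxioms
    (by
      rintro ⟨x, σ⟩ ⟨y, τ⟩ ⟨z, ρ⟩
      refine Prod.ext ?_ (mul_assoc σ τ ρ)
      funext i
      show x i * y (σ⁻¹ i) * z ((σ * τ)⁻¹ i) = x i * (y (σ⁻¹ i) * z (τ⁻¹ (σ⁻¹ i)))
      rw [mul_assoc, mul_inv_rev]
      rfl)
    (by
      rintro ⟨x, σ⟩
      refine Prod.ext ?_ (one_mul σ)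
      funext i
      show 1 * x ((1 : Equiv.Perm (Fin w))⁻¹ i) = x i
      simp)
    (by
      rintro ⟨x, σ⟩
      refine Prod.ext ?_ (inv_mul_cancel σ)
      funext i
      show (x (σ i))⁻¹ * x ((σ⁻¹)⁻¹ i) = 1
      simp)

end WrGroup

/-- The product `x_i · x_{σ⁻¹(i)} ⋯ x_{σ^{-(n-1)}(i)}` along the cycle of `σ` through `i`
(`n` being the length of that cycle). -/
def cycleProd {G : Type*} [Group G] {w : ℕ} (x : Fin w → G) (σ : Equiv.Perm (Fin w))
    (i : Fin w) : G :=
  ((List.range (Finset.univ.filter (fun j => σ.SameCycle i j)).card).map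
    (fun k => x ((σ⁻¹ ^ k) i))).prod

/-- The minimal representatives of the cycles of `σ` (one point in the support of each cycle,
including `1`-cycles). -/
def basepoints {w : ℕ} (σ : Equiv.Perm (Fin w)) : Finset (Fin w) :=
  Finset.univ.filter (fun i => ∀ j, σ.SameCycle i j → i ≤ j)

/-- The class function `φ^{∼⊗w}` on `G ≀ S_w`: its value on an element equivalent to
`y_{σ_1}(x_1) ⋯ y_{σ_n}(x_n)` is `φ(x_1) ⋯ φ(x_n)`. -/
def tilprod {G : Type*} [Group G] {w : ℕ} (φ : G → ℚ) (g : Wr G w) : ℚ :=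
  ∏ i ∈ basepoints g.2, φ (cycleProd g.1 g.2 i)

/-- The embedding of `∏_i (G ≀ S_{w_i})` into `G ≀ S_w` (as the underlying function of the
block-diagonal group embedding). -/
def embWr {G : Type*} [Group G] {η : Type*} [Fintype η] (ws : η → ℕ) {w : ℕ}
    (h : ∑ i, ws i = w) (g : ∀ i, Wr G (ws i)) : Wr G w :=
  ((fun j => (g ((embSigma ws h).symm j).1).1 ((embSigma ws h).symm j).2),
   ((embSigma ws h).symm.trans
      ((Equiv.sigmaCongrRight (fun i => ((g i).2 : Fin (ws i) ≃ Fin (ws i)))).trans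
        (embSigma ws h))))

/-- The class function `ζ_Ξ` on `G ≀ S_w` attached to a tuple `Ξ = ((φ_i, f_i))_i` with
`φ_i ∈ CF(G)` and `f_i ∈ CF(S_{w_i})`:
`ζ_Ξ = Ind_{∏_i G≀S_{w_i}}^{G≀S_w} ⊗_i (φ_i^{∼⊗w_i} · Inf f_i)`. -/
def zetaTuple {G : Type*} [Group G] [Fintype G] {η : Type*} [Fintype η] (ws : η → ℕ)
    {w : ℕ} (h : ∑ i, ws i = w) (φs : η → (G → ℚ))
    (fs : ∀ i, Equiv.Perm (Fin (ws i)) → ℚ) : Wr G w → ℚ :=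
  IndFun (embWr ws h) (fun g => ∏ i, tilprod (φs i) (g i) * fs i (g i).2)

/-- The type of all partitions (of arbitrary natural numbers). -/
abbrev PttAll : Type := Σ n : ℕ, Nat.Partition n

/-- Partitions of size at most `w`, with bounded first component (a finite type). -/
abbrev PBP (w : ℕ) : Type := (m : Fin (w + 1)) × Nat.Partition m

/-- `PMap_w(T)`: the (finite) set of maps from `T` to partitions, of total size `w`. -/
abbrev PMapw (T : Type*) [Fintype T] (w : ℕ) : Type _ :=
  {lam : T → PBP w // ∑ t, ((lam t).1 : ℕ) = w}

/-- For a map `λ̲` from `β` to partitions with `∑_t |λ̲(t)| = w` and a family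
`b : β → CF(G)`, the class function `ζ_{λ̲} = ζ_Ξ` for `Ξ = ((b(t), s_{λ̲(t)}))_{t ∈ β}`. -/
def zetaP {G : Type*} [Group G] [Fintype G] {β : Type*} [Fintype β] (b : β → (G → ℚ))
    {w : ℕ} (lam : {l : β → PttAll // ∑ t, (l t).1 = w}) : Wr G w → ℚ :=
  zetaTuple (fun t => (lam.1 t).1) lam.2 b (fun t => sFun (lam.1 t).2)

/-- `𝒞(S_n) = ℤ[Irr(S_n)]`: the `ℤ`-span of the irreducible characters of `S_n`
(virtual characters). -/
def VirtCharS (n : ℕ) : Submodule ℤ (Equiv.Perm (Fin n) → ℚ) :=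
  Submodule.span ℤ (Set.range (fun lam : Nat.Partition n => sFun lam))

/-- The group `𝒳 ≀ S_w`: the `ℤ`-span in `CF(G ≀ S_w)` of the class functions `ζ_Ξ` over all
tuples `Ξ = ((φ_1, f_1), …, (φ_n, f_n))` with each `φ_i ∈ 𝒳` and each `f_i` a virtual
character of some `S_{w_i}`, where `∑ w_i = w`. -/
def wreathSpan (G : Type*) [Group G] [Fintype G] (w : ℕ) (X : AddSubgroup (G → ℚ)) :
    AddSubgroup (Wr G w → ℚ) :=
  AddSubgroup.closure {ξ | ∃ (n : ℕ) (ws : Fin n → ℕ) (h : ∑ i, ws i = w)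
    (φs : Fin n → (G → ℚ)) (fs : ∀ i, Equiv.Perm (Fin (ws i)) → ℚ),
    (∀ i, φs i ∈ X) ∧ (∀ i, fs i ∈ VirtCharS (ws i)) ∧ ξ = zetaTuple ws h φs fs}

set_option linter.unusedSectionVars false

/-- Length of the cycle through `i`. -/
def clen {α : Type*} [Fintype α] (σ : Equiv.Perm α) (i : α) : ℕ :=
  (Finset.univ.filter (fun j => σ.SameCycle i j)).card

theorem clen_pos {α : Type*} [Fintype α] (σ : Equiv.Perm α) (i : α) : 0 < clen σ i := by
  unfold clen
  exact Finset.card_pos.mpr ⟨i, by simp [Equiv.Perm.SameCycle.refl]⟩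

theorem clen_congr {α : Type*} [Fintype α] (σ : Equiv.Perm α) {i j : α}
    (h : σ.SameCycle i j) : clen σ i = clen σ j := by
  unfold clen
  congr 1
  ext k
  simp only [Finset.mem_filter, Finset.mem_univ, true_and]
  exact ⟨fun h' => h.symm.trans h', fun h' => h.trans h'⟩

theorem clen_transport {α α' : Type*} [Fintype α] [Fintype α'] (σ : Equiv.Perm α)
    (σ' : Equiv.Perm α') (e : α → α') (he : Function.Injective e) (i : α)
    (h : ∀ j, σ'.SameCycle (e i) j ↔ ∃ k, σ.SameCycle i k ∧ e k = j) :
    clen σ' (e i) = clen σ i := by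
  unfold clen
  rw [← Finset.card_map ⟨e, he⟩]
  congr 1
  ext j
  simp [h]

theorem pow_clen {α : Type*} [Fintype α] (σ : Equiv.Perm α) (i : α) :
    (σ ^ clen σ i) i = i := by
  have h : Function.minimalPeriod (σ • ·) i = clen σ i := by
    rw [MulAction.minimalPeriod_eq_card]
    unfold clen
    rw [← Set.toFinset_card]
    congr 1
    ext j
    simp only [Set.mem_toFinset, Finset.mem_filter, Finset.mem_univ, true_and]
    constructor
    · rintro ⟨⟨_, n, rfl⟩, rfl⟩
      exact ⟨n, rfl⟩
    · rintro ⟨n, rfl⟩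
      exact ⟨⟨_, n, rfl⟩, rfl⟩
  have := Function.isPeriodicPt_minimalPeriod (fun x => σ • x) i
  rw [h] at this
  have h2 := this.eq
  rw [smul_iterate] at h2
  exact h2

theorem inv_pow_clen {α : Type*} [Fintype α] (σ : Equiv.Perm α) (i : α) :
    (σ⁻¹ ^ clen σ i) i = i := by
  rw [inv_pow, Equiv.Perm.inv_eq_iff_eq, pow_clen]

theorem cycleProd_eq {G : Type*} [Group G] {w : ℕ} (x : Fin w → G) (σ : Equiv.Perm (Fin w))
    (i : Fin w) : cycleProd x σ i =
      ((List.range (clen σ i)).map (fun k => x ((σ⁻¹ ^ k) i))).prod := by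
  unfold cycleProd clen
  congr!

section conj
variable {G : Type*} [Group G] {w : ℕ}

theorem wr_mul_fst (a b : Wr G w) (i) : (a * b).1 i = a.1 i * b.1 (a.2⁻¹ i) := rfl
theorem wr_mul_snd (a b : Wr G w) : (a * b).2 = a.2 * b.2 := rfl
theorem wr_inv_fst (a : Wr G w) (i) : (a⁻¹).1 i = (a.1 (a.2 i))⁻¹ := rfl
theorem wr_inv_snd (a : Wr G w) : (a⁻¹).2 = a.2⁻¹ := rfl

theorem wr_conj_snd (x g : Wr G w) : (x * g * x⁻¹).2 = x.2 * g.2 * x.2⁻¹ := rfl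

theorem wr_conj_fst (x g : Wr G w) (i) : (x * g * x⁻¹).1 i =
    x.1 i * g.1 (x.2⁻¹ i) * (x.1 ((x.2 * g.2 * x.2⁻¹)⁻¹ i))⁻¹ := by
  rw [wr_mul_fst, wr_mul_fst, wr_inv_fst]
  simp [wr_mul_snd, mul_assoc]

theorem prod_telescope (x g : Wr G w) (i : Fin w) (n : ℕ) :
    ((List.range n).map (fun k => (x * g * x⁻¹).1 (((x * g * x⁻¹).2⁻¹ ^ k) (x.2 i)))).prod
    = x.1 (x.2 i) * ((List.range n).map (fun k => g.1 ((g.2⁻¹ ^ k) i))).prod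
      * (x.1 (x.2 ((g.2⁻¹ ^ n) i)))⁻¹ := by
  have key : ∀ k : ℕ, ((x * g * x⁻¹).2⁻¹ ^ k) (x.2 i) = x.2 ((g.2⁻¹ ^ k) i) := by
    intro k
    rw [wr_conj_snd, conj_inv, conj_pow]
    simp
  induction n with
  | zero => simp
  | succ n ih =>
    rw [List.range_succ, List.map_append, List.prod_append, ih, List.map_append,
      List.prod_append]
    simp only [List.map_cons, List.map_nil, List.prod_cons, List.prod_nil, mul_one]
    rw [key, wr_conj_fst]
    have : (x.2 * g.2 * x.2⁻¹)⁻¹ (x.2 ((g.2⁻¹ ^ n) i)) = x.2 ((g.2⁻¹ ^ (n+1)) i) := by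
      rw [conj_inv, pow_succ']
      simp
    rw [this]
    simp [mul_assoc]

theorem clen_conj (σ τ : Equiv.Perm (Fin w)) (i : Fin w) :
    clen (τ * σ * τ⁻¹) (τ i) = clen σ i := by
  apply clen_transport σ _ τ τ.injective
  intro j
  rw [Equiv.Perm.sameCycle_conj]
  constructor
  · intro h
    exact ⟨τ⁻¹ j, by simpa using h, by simp⟩
  · rintro ⟨k, hk, rfl⟩
    simpa using hk

theorem cycleProd_conj (x g : Wr G w) (i : Fin w) :
    cycleProd (x * g * x⁻¹).1 (x * g * x⁻¹).2 (x.2 i) =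
      x.1 (x.2 i) * cycleProd g.1 g.2 i * (x.1 (x.2 i))⁻¹ := by
  rw [cycleProd_eq, cycleProd_eq, wr_conj_snd, clen_conj, ← wr_conj_snd, prod_telescope,
    inv_pow_clen]

theorem cycleProd_apply (φ : G → ℚ) (hφ : ∀ x g : G, φ (x * g * x⁻¹) = φ g)
    (g : Wr G w) (i : Fin w) :
    φ (cycleProd g.1 g.2 (g.2 i)) = φ (cycleProd g.1 g.2 i) := by
  have h := cycleProd_conj g g i
  rw [mul_inv_cancel_right] at h
  rw [h, hφ]

theorem inv_of_apply {α M : Type*} [Finite α] (σ : Equiv.Perm α) (F : α → M)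
    (h : ∀ i, F (σ i) = F i)
    {i j : α} (hij : σ.SameCycle i j) : F i = F j := by
  obtain ⟨n, -, hn, rfl⟩ := hij.exists_pow_eq''
  clear hn hij
  induction n with
  | zero => simp
  | succ n ih => rw [pow_succ', Equiv.Perm.mul_apply, h, ← ih]

theorem cycleProd_same (φ : G → ℚ) (hφ : ∀ x g : G, φ (x * g * x⁻¹) = φ g)
    (g : Wr G w) {i j : Fin w} (h : g.2.SameCycle i j) :
    φ (cycleProd g.1 g.2 i) = φ (cycleProd g.1 g.2 j) :=
  inv_of_apply g.2 (fun i => φ (cycleProd g.1 g.2 i)) (cycleProd_apply φ hφ g) h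
end conj

/-- A system of representatives of the cycles. -/
structure IsTr {α J : Type*} (σ : Equiv.Perm α) (s : J → α) : Prop where
  ex : ∀ a, ∃ j, σ.SameCycle (s j) a
  uniq : ∀ j j', σ.SameCycle (s j) (s j') → j = j'

namespace IsTr
variable {α J J' : Type*} {σ : Equiv.Perm α} {s : J → α} {s' : J' → α}

theorem exists_equiv (h : IsTr σ s) (h' : IsTr σ s') :
    ∃ e : J ≃ J', ∀ j, σ.SameCycle (s j) (s' (e j)) := by
  choose f hf using fun j => h'.ex (s j)
  choose f' hf' using fun j => h.ex (s' j)
  refine ⟨⟨f, f', fun j => ?_, fun j => ?_⟩, fun j => (hf j).symm⟩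
  · exact h.uniq _ _ ((hf' _).trans (hf j))
  · exact h'.uniq _ _ ((hf _).trans (hf' j))

/-- index of the cycle containing a point -/
def idx (h : IsTr σ s) (a : α) : J := (h.ex a).choose

theorem idx_spec (h : IsTr σ s) (a : α) : σ.SameCycle (s (h.idx a)) a := (h.ex a).choose_spec

theorem idx_eq_iff (h : IsTr σ s) (a : α) (j : J) : h.idx a = j ↔ σ.SameCycle (s j) a := by
  constructor
  · rintro rfl
    exact h.idx_spec a
  · intro hj
    exact h.uniq _ _ ((h.idx_spec a).trans hj.symm)

theorem idx_s (h : IsTr σ s) (j : J) : h.idx (s j) = j := by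
  rw [idx_eq_iff]

theorem idx_apply (h : IsTr σ s) (a : α) : h.idx (σ a) = h.idx a := by
  rw [idx_eq_iff, Equiv.Perm.sameCycle_apply_right]
  exact h.idx_spec a

theorem card_fibre [Fintype α] [Fintype J] {η : Type*} (h : IsTr σ s) (c : J → η) (i : η) :
    (Finset.univ.filter (fun a => c (h.idx a) = i)).card =
      ∑ j ∈ Finset.univ.filter (fun j => c j = i), clen σ (s j) := by
  rw [Finset.card_eq_sum_card_fiberwise (f := h.idx)
    (t := Finset.univ.filter (fun j => c j = i))]
  · apply Finset.sum_congr rfl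
    intro j hj
    unfold clen
    congr 1
    ext a
    simp only [Finset.mem_filter, Finset.mem_univ, true_and] at hj ⊢
    rw [h.idx_eq_iff]
    constructor
    · exact fun x => x.2
    · intro hx
      refine ⟨?_, hx⟩
      rw [(h.idx_eq_iff a j).2 hx, hj]
  · intro a ha
    simpa using ha

theorem sum_clen [Fintype α] [Fintype J] (h : IsTr σ s) :
    ∑ j, clen σ (s j) = Fintype.card α := by
  have := h.card_fibre (fun _ => ()) ()
  simpa using this.symm

theorem conj (h : IsTr σ s) (τ : Equiv.Perm α) : IsTr (τ * σ * τ⁻¹) (fun j => τ (s j)) := by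
  constructor
  · intro a
    obtain ⟨j, hj⟩ := h.ex (τ⁻¹ a)
    refine ⟨j, ?_⟩
    rw [Equiv.Perm.sameCycle_conj]
    simpa using hj
  · intro j j' hj
    rw [Equiv.Perm.sameCycle_conj] at hj
    exact h.uniq _ _ (by simpa using hj)

end IsTr

theorem isTr_basepoints {w : ℕ} (σ : Equiv.Perm (Fin w)) :
    IsTr σ (fun i : basepoints σ => (i : Fin w)) := by
  constructor
  · intro a
    obtain ⟨m, hm, hle⟩ := Finset.exists_min_image
      (Finset.univ.filter (fun j => σ.SameCycle a j)) id
      ⟨a, by simp [Equiv.Perm.SameCycle.refl]⟩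
    simp only [Finset.mem_filter, Finset.mem_univ, true_and, id] at hm hle
    refine ⟨⟨m, ?_⟩, hm.symm⟩
    unfold basepoints
    simp only [Finset.mem_filter, Finset.mem_univ, true_and]
    exact fun j hj => hle j (hm.trans hj)
  · rintro ⟨j, hj⟩ ⟨j', hj'⟩ h
    unfold basepoints at hj hj'
    simp only [Finset.mem_filter, Finset.mem_univ, true_and] at hj hj'
    exact Subtype.ext (le_antisymm (hj _ h) (hj' _ h.symm))

theorem cycM_eq {n : ℕ} (σ : Equiv.Perm (Fin n)) {J : Type*} [Fintype J] {s : J → Fin n}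
    (hs : IsTr σ s) : (Finset.univ.val : Multiset J).map (fun j => clen σ (s j)) = cycM σ := by
  have hne : ∀ c : σ.cycleFactorsFinset, ∃ a, a ∈ (c : Equiv.Perm (Fin n)).support := by
    rintro ⟨c, hc⟩
    rw [Equiv.Perm.mem_cycleFactorsFinset_iff] at hc
    obtain ⟨a, ha, -⟩ := hc.1
    exact ⟨a, by simpa using ha⟩
  choose f hf using hne
  have hcyc : ∀ c : σ.cycleFactorsFinset, (c : Equiv.Perm (Fin n)) = σ.cycleOf (f c) :=
    fun c => Equiv.Perm.cycle_is_cycleOf (hf c) c.2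
  have hmem : ∀ c : σ.cycleFactorsFinset, f c ∈ σ.support := fun c =>
    Equiv.Perm.mem_cycleFactorsFinset_support_le c.2 (hf c)
  let s0 : {i : Fin n // σ i = i} ⊕ σ.cycleFactorsFinset → Fin n := Sum.elim (fun i => i) f
  have hs0 : IsTr σ s0 := by
    constructor
    · intro a
      by_cases ha : σ a = a
      · exact ⟨Sum.inl ⟨a, ha⟩, Equiv.Perm.SameCycle.refl _ _⟩
      · refine ⟨Sum.inr ⟨σ.cycleOf a, ?_⟩, ?_⟩
        · rw [Equiv.Perm.cycleOf_mem_cycleFactorsFinset_iff]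
          simpa using ha
        · have := hf ⟨σ.cycleOf a, by
            rw [Equiv.Perm.cycleOf_mem_cycleFactorsFinset_iff]; simpa using ha⟩
          rw [Equiv.Perm.mem_support_cycleOf_iff] at this
          exact this.1.symm
    · rintro (⟨i, hi⟩ | c) (⟨j, hj⟩ | d) h
      · have : i = j := h.eq_of_left hi
        subst this; rfl
      · exfalso
        have h1 := (h.apply_eq_self_iff).1 hi
        have h2 := hmem d
        rw [Equiv.Perm.mem_support] at h2
        exact h2 h1
      · exfalso
        have h1 := (h.apply_eq_self_iff).2 hj
        have h2 := hmem c
        rw [Equiv.Perm.mem_support] at h2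
        exact h2 h1
      · congr 1
        apply Subtype.ext
        rw [hcyc c, hcyc d]
        exact Equiv.Perm.SameCycle.cycleOf_eq h
  obtain ⟨e, he⟩ := hs.exists_equiv hs0
  have h1 : (Finset.univ.val : Multiset J).map (fun j => clen σ (s j)) =
      (Finset.univ.val : Multiset _).map (fun j => clen σ (s0 j)) := by
    rw [← Finset.map_univ_equiv e, Finset.map_val, Multiset.map_map]
    apply Multiset.map_congr rfl
    intro j _
    exact clen_congr σ (he j)
  rw [h1, ← Finset.univ_disjSum_univ, Finset.val_disjSum, Multiset.disjSum, Multiset.map_add,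
    Multiset.map_map, Multiset.map_map]
  unfold cycM
  rw [add_comm]
  congr 1
  · rw [Equiv.Perm.cycleType_def]
    have : σ.cycleFactorsFinset.val = (Finset.univ : Finset σ.cycleFactorsFinset).val.map
        Subtype.val := by
      rw [Finset.univ_eq_attach, Finset.attach_val, Multiset.attach_map_val]
    rw [this, Multiset.map_map]
    apply Multiset.map_congr rfl
    intro c _
    simp only [Function.comp_apply, s0, Sum.elim_inr]
    unfold clen
    congr 1
    ext j
    simp only [Finset.mem_filter, Finset.mem_univ, true_and]
    rw [hcyc c, Equiv.Perm.mem_support_cycleOf_iff]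
    exact ⟨fun h => ⟨h, hmem c⟩, fun h => h.1⟩
  · have h2 : ∀ i ∈ (Finset.univ : Finset {i : Fin n // σ i = i}).val,
        ((fun j => clen σ (s0 j)) ∘ Sum.inl) i = 1 := by
      rintro ⟨i, hi⟩ _
      simp only [Function.comp_apply, s0, Sum.elim_inl]
      unfold clen
      rw [Finset.card_eq_one]
      refine ⟨i, ?_⟩
      ext j
      simp only [Finset.mem_filter, Finset.mem_univ, true_and, Finset.mem_singleton]
      constructor
      · intro h
        exact (h.eq_of_left hi).symm
      · rintro rfl
        exact Equiv.Perm.SameCycle.refl _ _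
    rw [Multiset.map_congr rfl h2, Multiset.map_const']
    congr 1
    have h3 : (Finset.univ.filter (fun i => σ i = i)).card + σ.support.card = n := by
      have := Finset.card_filter_add_card_filter_not (s := (Finset.univ : Finset (Fin n)))
        (fun i => σ i = i)
      rw [Finset.card_univ, Fintype.card_fin] at this
      convert this using 3
      ext a
      simp
    have h4 : Multiset.card (Finset.univ : Finset {i : Fin n // σ i = i}).val =
        (Finset.univ.filter (fun i => σ i = i)).card := by
      rw [Finset.card_val, Finset.card_univ, Fintype.card_subtype]
    omega

section emb
variable {G : Type*} [Group G] {η : Type*} [Fintype η] (ws : η → ℕ) {w : ℕ}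
    (h : ∑ i, ws i = w) (g : ∀ i, Wr G (ws i))

theorem embWr_fst (i : η) (a : Fin (ws i)) :
    (embWr ws h g).1 (embSigma ws h ⟨i, a⟩) = (g i).1 a := by
  have key : ∀ p : (Σ i, Fin (ws i)), p = ⟨i, a⟩ → (g p.1).1 p.2 = (g i).1 a := by
    rintro _ rfl
    rfl
  exact key _ (Equiv.symm_apply_apply _ _)

theorem embWr_snd (i : η) (a : Fin (ws i)) :
    (embWr ws h g).2 (embSigma ws h ⟨i, a⟩) = embSigma ws h ⟨i, (g i).2 a⟩ := by
  simp [embWr]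

theorem embWr_snd_inv (i : η) (a : Fin (ws i)) :
    (embWr ws h g).2⁻¹ (embSigma ws h ⟨i, a⟩) = embSigma ws h ⟨i, (g i).2⁻¹ a⟩ := by
  rw [Equiv.Perm.inv_eq_iff_eq, embWr_snd]
  simp

theorem embWr_snd_pow (i : η) (a : Fin (ws i)) (n : ℕ) :
    ((embWr ws h g).2 ^ n) (embSigma ws h ⟨i, a⟩) = embSigma ws h ⟨i, ((g i).2 ^ n) a⟩ := by
  induction n with
  | zero => simp
  | succ n ih => rw [pow_succ', Equiv.Perm.mul_apply, ih, embWr_snd, pow_succ']; rfl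

theorem embWr_snd_inv_pow (i : η) (a : Fin (ws i)) (n : ℕ) :
    ((embWr ws h g).2⁻¹ ^ n) (embSigma ws h ⟨i, a⟩) = embSigma ws h ⟨i, ((g i).2⁻¹ ^ n) a⟩ := by
  induction n with
  | zero => simp
  | succ n ih => rw [pow_succ', Equiv.Perm.mul_apply, ih, embWr_snd_inv, pow_succ']; rfl

theorem embWr_sameCycle (i : η) (a : Fin (ws i)) (y : Fin w) :
    (embWr ws h g).2.SameCycle (embSigma ws h ⟨i, a⟩) y ↔
      ∃ k, (g i).2.SameCycle a k ∧ embSigma ws h ⟨i, k⟩ = y := by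
  constructor
  · intro hy
    obtain ⟨n, -, -, rfl⟩ := hy.exists_pow_eq''
    refine ⟨((g i).2 ^ n) a, ⟨n, by simp⟩, ?_⟩
    rw [embWr_snd_pow]
  · rintro ⟨k, hk, rfl⟩
    obtain ⟨n, -, -, rfl⟩ := hk.exists_pow_eq''
    refine ⟨n, ?_⟩
    rw [zpow_natCast, embWr_snd_pow]

theorem embWr_clen (i : η) (a : Fin (ws i)) :
    clen (embWr ws h g).2 (embSigma ws h ⟨i, a⟩) = clen (g i).2 a := by
  apply clen_transport (g i).2 _ (fun a => embSigma ws h ⟨i, a⟩)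
  · intro a b hab
    simpa using hab
  · exact embWr_sameCycle ws h g i a

theorem embWr_cycleProd (i : η) (a : Fin (ws i)) :
    cycleProd (embWr ws h g).1 (embWr ws h g).2 (embSigma ws h ⟨i, a⟩) =
      cycleProd (g i).1 (g i).2 a := by
  rw [cycleProd_eq, cycleProd_eq, embWr_clen]
  congr 1
  apply List.map_congr_left
  intro k _
  rw [embWr_snd_inv_pow, embWr_fst]

theorem embWr_isTr {J : η → Type*} (s : ∀ i, J i → Fin (ws i)) (hs : ∀ i, IsTr (g i).2 (s i)) :
    IsTr (embWr ws h g).2 (fun p : (Σ i, J i) => embSigma ws h ⟨p.1, s p.1 p.2⟩) := by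
  constructor
  · intro a
    obtain ⟨⟨i, a⟩, rfl⟩ := (embSigma ws h).surjective a
    obtain ⟨j, hj⟩ := (hs i).ex a
    exact ⟨⟨i, j⟩, (embWr_sameCycle _ _ _ _ _ _).2 ⟨a, hj, rfl⟩⟩
  · rintro ⟨i, j⟩ ⟨i', j'⟩ hh
    obtain ⟨k, hk, hk'⟩ := (embWr_sameCycle _ _ _ _ _ _).1 hh
    simp only [EmbeddingLike.apply_eq_iff_eq] at hk'
    obtain rfl : i = i' := congrArg Sigma.fst hk'
    simp only [Sigma.mk.injEq, heq_eq_eq, true_and] at hk'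
    subst hk'
    have := (hs i).uniq j j' hk
    rw [this]

theorem embWr_injective : Function.Injective (embWr (G := G) ws h) := by
  intro g g' hg
  funext i
  refine Prod.ext ?_ ?_
  · funext a
    rw [← embWr_fst ws h g, hg, embWr_fst]
  · ext a
    have := embWr_snd ws h g i a
    rw [hg, embWr_snd] at this
    simp at this
    rw [this]

theorem exists_embWr (g : Wr G w)
    (hg : ∀ a, ((embSigma ws h).symm (g.2 a)).1 = ((embSigma ws h).symm a).1) :
    ∃ k, embWr ws h k = g := by
  have hg' : ∀ i a, ∃ b, g.2 (embSigma ws h ⟨i, a⟩) = embSigma ws h ⟨i, b⟩ := by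
    intro i a
    have := hg (embSigma ws h ⟨i, a⟩)
    obtain ⟨⟨i', b⟩, hb⟩ := (embSigma ws h).surjective (g.2 (embSigma ws h ⟨i, a⟩))
    rw [← hb] at this
    simp at this
    subst this
    exact ⟨b, hb.symm⟩
  choose f hf using hg'
  have hinj : ∀ i, Function.Injective (f i) := by
    intro i a b hab
    have : g.2 (embSigma ws h ⟨i, a⟩) = g.2 (embSigma ws h ⟨i, b⟩) := by
      rw [hf, hf, hab]
    simpa using this
  refine ⟨fun i => ((fun a => g.1 (embSigma ws h ⟨i, a⟩)),
    Equiv.ofBijective (f i) (Finite.injective_iff_bijective.1 (hinj i))), ?_⟩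
  refine Prod.ext ?_ ?_
  · funext a
    obtain ⟨⟨i, a⟩, rfl⟩ := (embSigma ws h).surjective a
    exact embWr_fst ws h _ i a
  · apply Equiv.ext
    intro a
    obtain ⟨⟨i, a⟩, rfl⟩ := (embSigma ws h).surjective a
    refine (embWr_snd ws h _ i a).trans ?_
    rw [hf]
    simp
end emb

section A
variable {G : Type*} {η J J' : Type*} [Fintype η] [Fintype J] [Fintype J']

/-- The contribution of a colouring `c` of the cycles. -/
def Tval (φ : η → G → ℚ) (F : η → Multiset ℕ → ℚ) (len : J → ℕ) (v : J → G) (c : J → η) : ℚ :=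
  (∏ j, φ (c j) (v j)) * ∏ i, F i ((Finset.univ.filter (fun j => c j = i)).val.map len)

theorem filter_map_equiv {M : Type*} (e : J ≃ J') (p : J → Prop) (p' : J' → Prop)
    (hp : ∀ j, p j ↔ p' (e j)) (f : J → M) (f' : J' → M) (hf : ∀ j, f j = f' (e j)) :
    (Finset.univ.filter p).val.map f = (Finset.univ.filter p').val.map f' := by
  have : (Finset.univ.filter p') = (Finset.univ.filter p).map e.toEmbedding := by
    ext j
    simp only [Finset.mem_filter, Finset.mem_univ, true_and, Finset.mem_map,
      Equiv.coe_toEmbedding]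
    constructor
    · intro h
      exact ⟨e.symm j, by rw [hp]; simpa using h, by simp⟩
    · rintro ⟨a, ha, rfl⟩
      exact (hp a).1 ha
  rw [this, Finset.map_val, Multiset.map_map]
  apply Multiset.map_congr rfl
  intro j _
  exact hf j

theorem Tval_equiv (φ : η → G → ℚ) (F : η → Multiset ℕ → ℚ) (len : J → ℕ) (v : J → G)
    (c : J → η) (len' : J' → ℕ) (v' : J' → G) (c' : J' → η) (e : J ≃ J')
    (hl : ∀ j, len j = len' (e j)) (hc : ∀ j, c j = c' (e j))
    (hv : ∀ j i, φ i (v j) = φ i (v' (e j))) :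
    Tval φ F len v c = Tval φ F len' v' c' := by
  unfold Tval
  congr 1
  · apply Fintype.prod_equiv e
    intro j
    rw [hc, hv]
  · apply Finset.prod_congr rfl
    intro i _
    congr 1
    apply filter_map_equiv e _ _ _ _ _ hl
    intro j
    rw [hc]

theorem filter_sigma_map {M : Type*} {K : η → Type*} [∀ i, Fintype (K i)] (f : (Σ i, K i) → M)
    (i : η) : (Finset.univ.filter (fun p : (Σ i, K i) => p.1 = i)).val.map f =
      (Finset.univ : Finset (K i)).val.map (fun k => f ⟨i, k⟩) := by
  have : (Finset.univ.filter (fun p : (Σ i, K i) => p.1 = i)) =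
      (Finset.univ : Finset (K i)).map (Function.Embedding.sigmaMk i) := by
    ext ⟨i', k⟩
    simp only [Finset.mem_filter, Finset.mem_univ, true_and, Finset.mem_map,
      Function.Embedding.sigmaMk_apply]
    constructor
    · rintro rfl
      exact ⟨k, rfl⟩
    · rintro ⟨a, ha⟩
      exact (congrArg Sigma.fst ha).symm
  rw [this, Finset.map_val, Multiset.map_map]
  rfl

variable [Group G] (ws : η → ℕ) {w : ℕ} (h : ∑ i, ws i = w)

theorem prod_eq_Tval (φ : η → G → ℚ) (F : η → Multiset ℕ → ℚ)
    (fs : ∀ i, Equiv.Perm (Fin (ws i)) → ℚ) (hfs : ∀ i σ, fs i σ = F i (cycM σ))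
    (k : ∀ i, Wr G (ws i)) :
    ∏ i, tilprod (φ i) (k i) * fs i (k i).2 =
      Tval φ F (fun p : (Σ i, basepoints (k i).2) =>
          clen (embWr ws h k).2 (embSigma ws h ⟨p.1, p.2⟩))
        (fun p => cycleProd (embWr ws h k).1 (embWr ws h k).2 (embSigma ws h ⟨p.1, p.2⟩))
        (fun p => p.1) := by
  unfold Tval
  rw [Finset.prod_mul_distrib]
  congr 1
  · rw [Fintype.prod_sigma]
    apply Finset.prod_congr rfl
    intro i _
    simp only [embWr_cycleProd]
    unfold tilprod
    rw [Finset.prod_coe_sort (basepoints (k i).2)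
      (fun a => φ i (cycleProd (k i).1 (k i).2 a))]
  · apply Finset.prod_congr rfl
    intro i _
    rw [hfs, filter_sigma_map, ← cycM_eq _ (isTr_basepoints (k i).2)]
    simp only [embWr_clen]

theorem wr_inner_sum (φ : η → G → ℚ) (hφ : ∀ i, ∀ x g : G, φ i (x * g * x⁻¹) = φ i g)
    (F : η → Multiset ℕ → ℚ) [Fintype G]
    (fs : ∀ i, Equiv.Perm (Fin (ws i)) → ℚ) (hfs : ∀ i σ, fs i σ = F i (cycM σ))
    (g x : Wr G w) (s : J → Fin w) (hs : IsTr g.2 s) :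
    (∑ k : ∀ i, Wr G (ws i), if embWr ws h k = x * g * x⁻¹ then
        ∏ i, tilprod (φ i) (k i) * fs i (k i).2 else 0) =
    if (∀ a, ((embSigma ws h).symm (x.2 (g.2 a))).1 = ((embSigma ws h).symm (x.2 a)).1) then
      Tval φ F (fun j => clen g.2 (s j)) (fun j => cycleProd g.1 g.2 (s j))
        (fun j => ((embSigma ws h).symm (x.2 (s j))).1) else 0 := by
  split_ifs with hx
  · obtain ⟨k, hk⟩ := exists_embWr ws h (x * g * x⁻¹) (by
      intro a
      rw [wr_conj_snd]
      have := hx (x.2⁻¹ a)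
      simpa using this)
    rw [Finset.sum_eq_single k]
    · rw [if_pos hk, prod_eq_Tval ws h φ F fs hfs k]
      have t1 := embWr_isTr ws h k (fun i (j : basepoints (k i).2) => (j : Fin (ws i)))
        (fun i => isTr_basepoints _)
      have t2 := hs.conj x.2
      rw [← wr_conj_snd, ← hk] at t2
      obtain ⟨e, he⟩ := t1.exists_equiv t2
      apply Tval_equiv φ F _ _ _ _ _ _ e
      · intro j
        rw [clen_congr _ (he j), hk, wr_conj_snd, clen_conj]
      · intro j
        have h3 : ∀ a, ((embSigma ws h).symm ((embWr ws h k).2 a)).1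
            = ((embSigma ws h).symm a).1 := by
          intro a
          obtain ⟨⟨i, a⟩, rfl⟩ := (embSigma ws h).surjective a
          rw [embWr_snd]
          simp
        have := inv_of_apply (embWr ws h k).2 (fun a => ((embSigma ws h).symm a).1) h3 (he j)
        rw [← this]
        simp
      · intro j i
        rw [cycleProd_same (φ i) (hφ i) _ (he j), hk, cycleProd_conj, hφ]
    · intro k' _ hk'
      rw [if_neg]
      intro hh
      exact hk' (embWr_injective ws h (hh.trans hk.symm))
    · intro hh
      exact absurd (Finset.mem_univ _) hh
  · apply Finset.sum_eq_zero
    intro k _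
    rw [if_neg]
    intro hk
    apply hx
    intro a
    have h1 : x.2 (g.2 a) = (x * g * x⁻¹).2 (x.2 a) := by
      rw [wr_conj_snd]; simp
    rw [h1, ← hk]
    obtain ⟨⟨i, b⟩, hb⟩ := (embSigma ws h).surjective (x.2 a)
    rw [← hb, embWr_snd]
    simp

theorem card_perm_comp {α : Type*} [Fintype α] (f f' : α → η)
    [DecidablePred (fun τ : Equiv.Perm α => ∀ a, f (τ a) = f' a)]
    (hff : ∀ i, (Finset.univ.filter (fun a => f a = i)).card =
      (Finset.univ.filter (fun a => f' a = i)).card) :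
    (Finset.univ.filter (fun τ : Equiv.Perm α => ∀ a, f (τ a) = f' a)).card =
      ∏ i, ((Finset.univ.filter (fun a => f a = i)).card).factorial := by
  have : ∀ i, Nonempty ({a // f' a = i} ≃ {a // f a = i}) := by
    intro i
    apply Fintype.card_eq.1
    rw [Fintype.card_subtype, Fintype.card_subtype, hff]
  have e : ∀ i, ({a // f' a = i} ≃ {a // f a = i}) := fun i => Classical.choice (this i)
  let τ0 : Equiv.Perm α := (Equiv.sigmaFiberEquiv f').symm.trans
    ((Equiv.sigmaCongrRight e).trans (Equiv.sigmaFiberEquiv f))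
  have hτ0 : ∀ a, f (τ0 a) = f' a := by
    intro a
    exact (e (f' a) ⟨a, rfl⟩).2
  have h2 := DomMulAct.stabilizer_card f
  have h3 : ∀ i, Fintype.card {a // f a = i} = (Finset.univ.filter (fun a => f a = i)).card :=
    fun i => Fintype.card_subtype _
  simp only [h3] at h2
  rw [← h2, ← Fintype.card_subtype]
  apply Fintype.card_congr
  refine (Equiv.mulRight τ0⁻¹).subtypeEquiv ?_
  intro τ
  rw [funext_iff]
  simp only [Equiv.coe_mulRight, Function.comp_apply, Equiv.Perm.mul_apply]
  constructor
  · intro hh a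
    rw [hh, ← hτ0]
    simp
  · intro hh a
    have := hh (τ0 a)
    rw [hτ0] at this
    simpa using this

theorem card_wr [Fintype G] (n : ℕ) :
    Fintype.card (Wr G n) = Fintype.card G ^ n * n.factorial := by
  have : Fintype.card (Wr G n) = Fintype.card ((Fin n → G) × Equiv.Perm (Fin n)) := rfl
  rw [this, Fintype.card_prod, Fintype.card_perm, Fintype.card_fun, Fintype.card_fin]

theorem card_wr_filter [Fintype G] (n : ℕ) (p : Equiv.Perm (Fin n) → Prop)
    [DecidablePred p] :
    (Finset.univ.filter (fun x : Wr G n => p x.2)).card =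
      Fintype.card G ^ n * (Finset.univ.filter p).card := by
  rw [← Fintype.card_subtype, ← Fintype.card_subtype]
  have e : {x : Wr G n // p x.2} ≃ (Fin n → G) × {τ // p τ} :=
    ⟨fun x => (x.1.1, ⟨x.1.2, x.2⟩), fun y => ⟨(y.1, y.2.1), y.2.2⟩, fun _ => rfl, fun _ => rfl⟩
  rw [Fintype.card_congr e, Fintype.card_prod, Fintype.card_fun, Fintype.card_fin]

/-- **Formula A.** -/
theorem zetaTuple_eq [Fintype G] (φ : η → G → ℚ)
    (hφ : ∀ i, ∀ x g : G, φ i (x * g * x⁻¹) = φ i g)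
    (F : η → Multiset ℕ → ℚ) (hF : ∀ i M, M.sum ≠ ws i → F i M = 0)
    (fs : ∀ i, Equiv.Perm (Fin (ws i)) → ℚ) (hfs : ∀ i σ, fs i σ = F i (cycM σ))
    (g : Wr G w) (s : J → Fin w) (hs : IsTr g.2 s) :
    zetaTuple ws h φ fs g = ∑ c : J → η,
      Tval φ F (fun j => clen g.2 (s j)) (fun j => cycleProd g.1 g.2 (s j)) c := by
  unfold zetaTuple IndFun
  have h1 : ∀ x : Wr G w, _ := fun x => wr_inner_sum ws h φ hφ F fs hfs g x s hs
  have hcardH : (Fintype.card (∀ i, Wr G (ws i)) : ℚ) =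
      (Fintype.card G : ℚ) ^ w * ∏ i, ((ws i).factorial : ℚ) := by
    rw [Fintype.card_pi]
    simp only [card_wr]
    rw [Finset.prod_mul_distrib, Finset.prod_pow_eq_pow_sum, h]
    push_cast
    rfl
  rw [inv_mul_eq_iff_eq_mul₀ (by rw [Nat.cast_ne_zero]; exact Fintype.card_ne_zero)]
  rw [Finset.sum_congr rfl (fun x _ => h1 x), hcardH, Finset.mul_sum]
  -- group by the colouring
  rw [← Finset.sum_fiberwise (s := Finset.univ)
    (g := fun (x : Wr G w) (j : J) => ((embSigma ws h).symm (x.2 (s j))).1)]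
  apply Finset.sum_congr rfl
  intro c _
  set T := Tval φ F (fun j => clen g.2 (s j)) (fun j => cycleProd g.1 g.2 (s j)) c with hT
  have h2 : ∀ x ∈ Finset.univ.filter
      (fun x : Wr G w => (fun j => ((embSigma ws h).symm (x.2 (s j))).1) = c),
      (if (∀ a, ((embSigma ws h).symm (x.2 (g.2 a))).1 = ((embSigma ws h).symm (x.2 a)).1) then
        Tval φ F (fun j => clen g.2 (s j)) (fun j => cycleProd g.1 g.2 (s j))
        (fun j => ((embSigma ws h).symm (x.2 (s j))).1) else 0) =
      if (∀ a, ((embSigma ws h).symm (x.2 a)).1 = c (hs.idx a)) then T else 0 := by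
    intro x hx
    simp only [Finset.mem_filter, Finset.mem_univ, true_and] at hx
    rw [hx]
    congr 1
    apply propext
    constructor
    · intro hh a
      rw [← hx]
      exact (inv_of_apply g.2 (fun a => ((embSigma ws h).symm (x.2 a)).1) hh
        (hs.idx_spec a)).symm
    · intro hh a
      rw [hh, hh, hs.idx_apply]
  rw [Finset.sum_congr rfl h2]
  clear h2
  rw [← Finset.sum_filter, Finset.filter_filter, Finset.sum_const, nsmul_eq_mul]
  have h3 : (Finset.univ.filter (fun x : Wr G w =>
      (fun j => ((embSigma ws h).symm (x.2 (s j))).1) = c ∧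
      ∀ a, ((embSigma ws h).symm (x.2 a)).1 = c (hs.idx a))).card =
      Fintype.card G ^ w * (Finset.univ.filter (fun τ : Equiv.Perm (Fin w) =>
        ∀ a, ((embSigma ws h).symm (τ a)).1 = c (hs.idx a))).card := by
    refine Eq.trans ?_ (card_wr_filter w _)
    congr 1
    ext x
    simp only [Finset.mem_filter, Finset.mem_univ, true_and]
    constructor
    · exact fun h => h.2
    · intro hh
      refine ⟨?_, hh⟩
      funext j
      rw [hh, hs.idx_s]
  rw [h3]
  have hcf0 : ∀ i, (Finset.univ.filter (fun a : Fin w => ((embSigma ws h).symm a).1 = i)).card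
      = ws i := by
    intro i
    have : (Finset.univ.filter (fun a : Fin w => ((embSigma ws h).symm a).1 = i)) =
        (Finset.univ : Finset (Fin (ws i))).map
          ((Function.Embedding.sigmaMk i).trans (embSigma ws h).toEmbedding) := by
      ext a
      obtain ⟨⟨i', a⟩, rfl⟩ := (embSigma ws h).surjective a
      simp only [Finset.mem_filter, Finset.mem_univ, true_and, Finset.mem_map,
        Equiv.symm_apply_apply, Function.Embedding.trans_apply, Equiv.coe_toEmbedding,
        EmbeddingLike.apply_eq_iff_eq, Function.Embedding.sigmaMk_apply]
      constructor
      · rintro rfl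
        exact ⟨a, rfl⟩
      · rintro ⟨b, hb⟩
        exact (congrArg Sigma.fst hb).symm
    rw [this, Finset.card_map, Finset.card_univ, Fintype.card_fin]
  by_cases hsz : ∀ i, (Finset.univ.filter (fun a => c (hs.idx a) = i)).card = ws i
  · have h5 := card_perm_comp (fun a => ((embSigma ws h).symm a).1) (fun a => c (hs.idx a))
        (fun i => by rw [hcf0, hsz])
    simp only [hcf0] at h5
    congr 1
    push_cast
    congr 1
    rw [← Nat.cast_prod, ← h5]
    congr!
  · have hT0 : T = 0 := by
      push Not at hsz
      obtain ⟨i, hi⟩ := hsz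
      rw [hs.card_fibre] at hi
      rw [hT]
      unfold Tval
      rw [Finset.prod_eq_zero (Finset.mem_univ i) (hF i _ hi), mul_zero]
    rw [hT0, mul_zero, mul_zero]
end A

section MC
theorem exists_equiv_of_map_eq {J J' M : Type*} [Fintype J] [Fintype J'] (f : J → M) (f' : J' → M)
    (h : Finset.univ.val.map f = Finset.univ.val.map f') :
    ∃ e : J ≃ J', ∀ j, f j = f' (e j) := by
  have h1 : ∀ v, Nonempty ({j // f j = v} ≃ {j // f' j = v}) := by
    intro v
    apply Fintype.card_eq.1
    have := congrArg (Multiset.count v) h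
    rw [Multiset.count_map, Multiset.count_map] at this
    rw [Fintype.card_subtype, Fintype.card_subtype]
    simp only [eq_comm (a := v)] at this
    exact this
  have e : ∀ v, ({j // f j = v} ≃ {j // f' j = v}) := fun i => Classical.choice (h1 i)
  refine ⟨(Equiv.sigmaFiberEquiv f).symm.trans
    ((Equiv.sigmaCongrRight e).trans (Equiv.sigmaFiberEquiv f')), ?_⟩
  intro j
  exact (e (f j) ⟨j, rfl⟩).2.symm

theorem map_getD_sort (M : Multiset ℕ) :
    (Finset.univ : Finset (Fin (Multiset.card M))).val.map
      (fun i : Fin (Multiset.card M) => (M.sort (· ≤ ·)).getD i 0) = M := by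
  rw [Fin.univ_val_map]
  conv_rhs => rw [← Multiset.sort_eq M (· ≤ ·)]
  congr 1
  apply List.ext_getElem
  · simp
  · intro n h1 h2
    simp [List.getD_eq_getElem _ _ h2]

/-- Counting maps with prescribed fibre sums. -/
def mc {J I : Type*} [Fintype J] [DecidableEq I] (l : J → ℕ) (a : I → ℕ) : ℕ :=
  Nat.card {f : J → I // ∀ i, ∑ j ∈ Finset.univ.filter (fun j => f j = i), l j = a i}

theorem mc_congr {J I J' I' : Type*} [Fintype J] [DecidableEq I] [Fintype J'] [DecidableEq I']
    (l : J → ℕ) (a : I → ℕ) (l' : J' → ℕ) (a' : I' → ℕ) (e : J ≃ J') (d : I ≃ I')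
    (he : ∀ j, l j = l' (e j)) (hd : ∀ i, a i = a' (d i)) : mc l a = mc l' a' := by
  apply Nat.card_congr
  refine (Equiv.arrowCongr e d).subtypeEquiv ?_
  intro f
  rw [← d.forall_congr_right]
  apply forall_congr'
  intro i
  rw [hd]
  have : (∑ j ∈ Finset.univ.filter (fun j => f j = i), l j) =
      ∑ j ∈ Finset.univ.filter (fun j => (Equiv.arrowCongr e d) f j = d i), l' j := by
    rw [Finset.sum_filter, Finset.sum_filter]
    apply Fintype.sum_equiv e
    intro j
    simp [he]
  rw [this]

theorem Mcount_eq_mc (lam mu : Multiset ℕ) : Mcount lam mu =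
    mc (fun j : Fin (Multiset.card mu) => (mu.sort (· ≤ ·)).getD j 0)
     (fun j : Fin (Multiset.card lam) => (lam.sort (· ≤ ·)).getD j 0) := by
  unfold Mcount mc
  rw [Nat.card_eq_fintype_card]

theorem Mcount_map {J I : Type*} [Fintype J] [Fintype I] [DecidableEq I] (l : J → ℕ) (a : I → ℕ) :
    Mcount (Finset.univ.val.map a) (Finset.univ.val.map l) = mc l a := by
  obtain ⟨e, he⟩ := exists_equiv_of_map_eq _ _ (map_getD_sort (Finset.univ.val.map l))
  obtain ⟨d, hd⟩ := exists_equiv_of_map_eq _ _ (map_getD_sort (Finset.univ.val.map a))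
  rw [← mc_congr _ _ l a e d he hd]
  exact Mcount_eq_mc _ _

theorem exists_index (M : Multiset ℕ) : ∃ (n : ℕ) (a : Fin n → ℕ), Finset.univ.val.map a = M :=
  ⟨_, _, map_getD_sort M⟩

theorem mc_ne_zero {J I : Type*} [Fintype J] [DecidableEq I] {l : J → ℕ} {a : I → ℕ}
    (h : mc l a ≠ 0) :
    ∃ f : J → I, ∀ i, ∑ j ∈ Finset.univ.filter (fun j => f j = i), l j = a i := by
  unfold mc at h
  by_contra hne
  apply h
  have : IsEmpty {f : J → I // ∀ i, ∑ j ∈ Finset.univ.filter (fun j => f j = i), l j = a i} :=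
    ⟨fun f => hne ⟨f.1, f.2⟩⟩
  exact Nat.card_of_isEmpty

theorem Mcount_sum {lam mu : Multiset ℕ} (h : Mcount lam mu ≠ 0) : mu.sum = lam.sum := by
  obtain ⟨n, a, rfl⟩ := exists_index lam
  obtain ⟨m, l, rfl⟩ := exists_index mu
  rw [Mcount_map] at h
  obtain ⟨f, hf⟩ := mc_ne_zero h
  show ∑ j, l j = ∑ i, a i
  rw [← Finset.sum_fiberwise Finset.univ f]
  exact Finset.sum_congr rfl (fun i _ => hf i)

/-- If all parts of `lam` are positive then `Mcount lam mu ≠ 0` forces `lam` to have at most as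
many parts as `mu`, with equality of cardinalities only if they are equal. -/
theorem Mcount_card {lam mu : Multiset ℕ} (h : Mcount lam mu ≠ 0) (hp : ∀ x ∈ lam, 0 < x) :
    Multiset.card lam ≤ Multiset.card mu ∧
      (Multiset.card lam = Multiset.card mu → lam = mu) := by
  obtain ⟨n, a, rfl⟩ := exists_index lam
  obtain ⟨m, l, rfl⟩ := exists_index mu
  rw [Mcount_map] at h
  obtain ⟨f, hf⟩ := mc_ne_zero h
  have hsurj : Function.Surjective f := by
    intro i
    by_contra hne
    push Not at hne
    have h1 := hf i
    rw [Finset.filter_false_of_mem (fun j _ => hne j), Finset.sum_empty] at h1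
    have h2 := hp (a i) (Multiset.mem_map_of_mem _ (Finset.mem_univ i))
    omega
  constructor
  · simpa using Fintype.card_le_of_surjective f hsurj
  · intro hc
    have hbij : Function.Bijective f :=
      (Fintype.bijective_iff_surjective_and_card f).2 ⟨hsurj, by simpa using hc.symm⟩
    have h3 : ∀ j, l j = a (f j) := by
      intro j
      rw [← hf (f j)]
      rw [Finset.sum_eq_single j]
      · intro j' hj' hne
        simp only [Finset.mem_filter, Finset.mem_univ, true_and] at hj'
        exact absurd (hbij.1 hj') hne
      · simp
    have h4 : l = a ∘ (Equiv.ofBijective f hbij) := funext h3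
    rw [h4, ← Multiset.map_map, Multiset.map_univ_val_equiv]

theorem Mcount_self (lam : Multiset ℕ) : Mcount lam lam ≠ 0 := by
  obtain ⟨n, a, rfl⟩ := exists_index lam
  rw [Mcount_map]
  unfold mc
  rw [Nat.card_eq_fintype_card]
  apply Nat.ne_of_gt
  apply Fintype.card_pos_iff.2
  refine ⟨⟨id, ?_⟩⟩
  intro i
  simp [Finset.filter_eq']

end MC

section HF
variable {G : Type*} {η J I : Type*} [Fintype η] [Fintype J] [Fintype I]

theorem filter_map_subtype {M : Type*} (q : J → Prop) [DecidablePred q] (f : J → M) :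
    (Finset.univ.filter q).val.map f =
      (Finset.univ : Finset {j // q j}).val.map (fun j => f j.1) := by
  have : Finset.univ.filter q =
      (Finset.univ : Finset {j // q j}).map (Function.Embedding.subtype q) := by
    ext j
    simp
  rw [this, Finset.map_val, Multiset.map_map]
  rfl

theorem sub_sum (len : J → ℕ) (p : I → η) (c : J → η) (c' : J → I)
    (hc : ∀ j, p (c' j) = c j) (i : η) (f : {j // c j = i} → {k // p k = i})
    (hf : ∀ j, (f j).1 = c' j.1) (k : I) (hk : p k = i) :
    ∑ j ∈ Finset.univ.filter (fun j => f j = ⟨k, hk⟩), len j.1 =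
      ∑ j ∈ Finset.univ.filter (fun j => c' j = k), len j := by
  have : Finset.univ.filter (fun j => c' j = k) =
      (Finset.univ.filter (fun j => f j = ⟨k, hk⟩)).map
        (Function.Embedding.subtype (fun j => c j = i)) := by
    ext j
    simp only [Finset.mem_filter, Finset.mem_univ, true_and, Finset.mem_map,
      Function.Embedding.subtype_apply, Subtype.exists, exists_and_right, exists_eq_right]
    constructor
    · intro hj
      have hci : c j = i := by rw [← hc, hj, hk]
      exact ⟨hci, Subtype.ext ((hf ⟨j, hci⟩).trans hj)⟩
    · rintro ⟨hci, h⟩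
      rw [← hf ⟨j, hci⟩, h]
  rw [this, Finset.sum_map]
  rfl

/-- maps over a base with fibre conditions decompose as products -/
def fibreEquiv (len : J → ℕ) (p : I → η) (a : I → ℕ) (c : J → η) :
    {c' : J → I // (∀ j, p (c' j) = c j) ∧
        ∀ k, ∑ j ∈ Finset.univ.filter (fun j => c' j = k), len j = a k} ≃
      ∀ i, {f : {j // c j = i} → {k // p k = i} //
        ∀ k, ∑ j ∈ Finset.univ.filter (fun j => f j = k), len j.1 = a k.1} where
  toFun c' := fun i => ⟨fun j => ⟨c'.1 j.1, by rw [c'.2.1 j.1, j.2]⟩, by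
    rintro ⟨k, hk⟩
    rw [sub_sum len p c c'.1 c'.2.1 i _ (fun _ => rfl)]
    exact c'.2.2 k⟩
  invFun f := ⟨fun j => (f (c j)).1 ⟨j, rfl⟩, by
    refine ⟨fun j => ((f (c j)).1 ⟨j, rfl⟩).2, ?_⟩
    intro k
    rw [← sub_sum len p c _ (fun j => ((f (c j)).1 ⟨j, rfl⟩).2) (p k) (f (p k)).1 _ k rfl]
    · exact (f (p k)).2 ⟨k, rfl⟩
    · rintro ⟨j, hj⟩
      generalize p k = i at hj
      subst hj
      rfl⟩
  left_inv c' := by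
    rfl
  right_inv f := by
    funext i
    apply Subtype.ext
    funext ⟨j, hj⟩
    subst hj
    rfl

/-- The fibre-sum condition. -/
def FS (len : J → ℕ) (a : I → ℕ) (c : J → I) : Prop :=
  ∀ k, ∑ j ∈ Finset.univ.filter (fun j => c j = k), len j = a k

/-- **Formula B.** -/
theorem Tval_Mcount (φ : η → G → ℚ) (len : J → ℕ) (v : J → G) (p : I → η) (a : I → ℕ) :
    ∑ c : J → η, Tval φ (fun i M => (Mcount ((Finset.univ.filter (fun k => p k = i)).val.map a) M
      : ℚ)) len v c =
    ∑ c : J → I, if FS len a c then ∏ j, φ (p (c j)) (v j) else 0 := by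
  rw [← Finset.sum_fiberwise (s := (Finset.univ : Finset (J → I))) (g := fun c' j => p (c' j))]
  apply Finset.sum_congr rfl
  intro c _
  have h1 : ∀ c' ∈ Finset.univ.filter (fun c' : J → I => (fun j => p (c' j)) = c),
      (if FS len a c' then ∏ j, φ (p (c' j)) (v j) else 0) =
      if FS len a c' then ∏ j, φ (c j) (v j) else 0 := by
    intro c' hc'
    simp only [Finset.mem_filter, Finset.mem_univ, true_and] at hc'
    rw [← hc']
  rw [Finset.sum_congr rfl h1, ← Finset.sum_filter, Finset.sum_const, nsmul_eq_mul, mul_comm]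
  unfold Tval
  congr 1
  rw [← Nat.cast_prod]
  congr 1
  rw [Finset.filter_filter, ← Fintype.card_subtype, ← Nat.card_eq_fintype_card]
  have e := Nat.card_congr (fibreEquiv len p a c)
  rw [Nat.card_pi] at e
  have h2 : ∀ i, Mcount ((Finset.univ.filter (fun k => p k = i)).val.map a)
      ((Finset.univ.filter (fun k => c k = i)).val.map len) =
      Nat.card {f : {j // c j = i} → {k // p k = i} //
        ∀ k, ∑ j ∈ Finset.univ.filter (fun j => f j = k), len j.1 = a k.1} := by
    intro i
    rw [filter_map_subtype, filter_map_subtype, Mcount_map]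
    rfl
  rw [Finset.prod_congr rfl (fun i _ => h2 i), ← e]
  apply Nat.card_congr
  apply Equiv.subtypeEquivRight
  intro c'
  rw [funext_iff]
  rfl

end HF

section JT

theorem map_getD_rev (M : Multiset ℕ) :
    (Finset.univ : Finset (Fin (Multiset.card M))).val.map
      (fun i : Fin (Multiset.card M) => (M.sort (· ≤ ·)).reverse.getD i 0) = M := by
  rw [Fin.univ_val_map]
  conv_rhs => rw [← Multiset.sort_eq M (· ≤ ·), ← Multiset.coe_reverse]
  congr 1
  apply List.ext_getElem
  · simp
  · intro n h1 h2
    rw [List.getElem_ofFn]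
    exact List.getD_eq_getElem _ _ h2

theorem rev_antitone (M : Multiset ℕ) (i j : Fin (Multiset.card M)) (h : i ≤ j) :
    (M.sort (· ≤ ·)).reverse.getD j 0 ≤ (M.sort (· ≤ ·)).reverse.getD i 0 := by
  have hl : (M.sort (· ≤ ·)).reverse.length = Multiset.card M := by simp
  rw [List.getD_eq_getElem _ _ (by rw [hl]; exact j.2),
    List.getD_eq_getElem _ _ (by rw [hl]; exact i.2)]
  have hs : (M.sort (· ≤ ·)).reverse.Pairwise (· ≥ ·) := by
    rw [List.pairwise_reverse]
    exact Multiset.pairwise_sort M _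
  rcases eq_or_lt_of_le h with rfl | h
  · exact le_rfl
  · exact List.pairwise_iff_getElem.1 hs _ _ _ _ h

/-- Multiset attached to a permutation in the Jacobi-Trudi expansion. -/
def jt {l : ℕ} (L : Fin l → ℕ) (σ : Equiv.Perm (Fin l)) : Multiset ℕ :=
  (Multiset.map (fun i : Fin l => L i + (σ i : ℕ) - (i : ℕ))
            (Finset.univ.val : Multiset (Fin l))).filter (fun x => x ≠ 0)

theorem sum_filter_ne (M : Multiset ℕ) (f : ℕ → ℕ) (hf : f 0 = 0) :
    ((M.filter (fun x => x ≠ 0)).map f).sum = (M.map f).sum := by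
  induction M using Multiset.induction_on with
  | empty => rfl
  | cons a M ih =>
    by_cases ha : a = 0
    · subst ha
      simp [hf, ih]
    · simp [ha, ih]

theorem jt_sum {l : ℕ} (L : Fin l → ℕ) (σ : Equiv.Perm (Fin l))
    (hok : ∀ i : Fin l, (i : ℕ) ≤ L i + (σ i : ℕ)) : (jt L σ).sum = ∑ i, L i := by
  have h1 := sum_filter_ne (Multiset.map (fun i : Fin l => L i + (σ i : ℕ) - (i : ℕ))
            (Finset.univ.val : Multiset (Fin l))) id rfl
  rw [Multiset.map_id, Multiset.map_id] at h1
  unfold jt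
  rw [h1]
  show ∑ i : Fin l, (L i + (σ i : ℕ) - (i : ℕ)) = _
  zify
  rw [Finset.sum_congr rfl (fun i _ => by rw [Nat.cast_sub (hok i)])]
  push_cast
  rw [Finset.sum_sub_distrib, Finset.sum_add_distrib,
    Equiv.sum_comp σ (fun i => ((i : ℕ) : ℤ))]
  ring

/-- sum of squares -/
def sqM (M : Multiset ℕ) : ℕ := (M.map (fun x => x ^ 2)).sum

theorem jt_sq {l : ℕ} (L : Fin l → ℕ) (hL : ∀ i j, i ≤ j → L j ≤ L i) (σ : Equiv.Perm (Fin l))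
    (hok : ∀ i : Fin l, (i : ℕ) ≤ L i + (σ i : ℕ)) (hσ : σ ≠ 1) :
    sqM (Finset.univ.val.map L) < sqM (jt L σ) := by
  have h1 := sum_filter_ne (Multiset.map (fun i : Fin l => L i + (σ i : ℕ) - (i : ℕ))
            (Finset.univ.val : Multiset (Fin l))) (fun x => x ^ 2) rfl
  unfold sqM jt
  rw [h1, Multiset.map_map, Multiset.map_map]
  show ∑ i : Fin l, (L i) ^ 2 < ∑ i : Fin l, (L i + (σ i : ℕ) - (i : ℕ)) ^ 2
  zify
  rw [Finset.sum_congr (s₁ := Finset.univ)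
    (f := fun i => ((L i + (σ i : ℕ) - (i : ℕ) : ℕ) : ℤ) ^ 2) rfl
    (fun i _ => by rw [Nat.cast_sub (hok i)])]
  set f : Fin l → ℤ := fun i => (L i : ℤ) - (i : ℕ) with hf
  set g : Fin l → ℤ := fun i => ((i : ℕ) : ℤ) with hg
  have hanti : ∀ i j, i < j → f j < f i := by
    intro i j hij
    have := hL i j hij.le
    have h2 : (i : ℕ) < j := hij
    simp only [hf]
    omega
  have hav : Antivary f g := by
    intro i j hij
    simp only [hg, Nat.cast_lt] at hij
    exact (hanti i j hij).le
  have hnot : ¬ Antivary f (g ∘ σ) := by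
    intro hav2
    apply hσ
    have hmono : StrictMono (σ⁻¹ : Equiv.Perm (Fin l)) := by
      intro a b hab
      by_contra hle
      have h4 : g ((σ) (σ⁻¹ a)) < g (σ (σ⁻¹ b)) := by
        simpa [hg] using hab
      have h3 := hav2 h4
      have h5 : σ⁻¹ b < σ⁻¹ a := by
        rcases lt_trichotomy (σ⁻¹ a) (σ⁻¹ b) with h | h | h
        · exact absurd h hle
        · exact absurd (σ⁻¹.injective h) hab.ne
        · exact h
      have := hanti _ _ h5
      omega
    have h6 : (⇑(σ⁻¹ : Equiv.Perm (Fin l))) = id :=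
      (StrictMono.range_inj hmono strictMono_id).1
        (by rw [(σ⁻¹ : Equiv.Perm (Fin l)).surjective.range_eq]; simp)
    rw [← inv_eq_one]
    ext i
    rw [h6]
    rfl
  have key := (hav.sum_mul_lt_sum_mul_comp_perm_iff (σ := σ)).2 hnot
  have e1 : ∑ i, (L i : ℤ) ^ 2 = ∑ i, (f i) ^ 2 + 2 * ∑ i, f i * g i + ∑ i, (g i) ^ 2 := by
    rw [Finset.mul_sum, ← Finset.sum_add_distrib, ← Finset.sum_add_distrib]
    apply Finset.sum_congr rfl
    intro i _
    simp only [hf, hg]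
    ring
  have e2 : ∑ i, ((L i + (σ i : ℕ) : ℕ) - ((i : ℕ) : ℤ)) ^ 2 =
      ∑ i, (f i) ^ 2 + 2 * ∑ i, f i * g (σ i) + ∑ i, (g i) ^ 2 := by
    rw [← Equiv.sum_comp σ (fun i => (g i) ^ 2)]
    rw [Finset.mul_sum, ← Finset.sum_add_distrib, ← Finset.sum_add_distrib]
    apply Finset.sum_congr rfl
    intro i _
    simp only [hf, hg]
    push_cast
    ring
  simp only [smul_eq_mul] at key
  rw [e1, e2]
  linarith

end JT

section SV

/-- `h_λ` as a function on multisets -/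
def hM (lam : Multiset ℕ) : Multiset ℕ → ℚ := fun M => (Mcount lam M : ℚ)

/-- sorted parts -/
def LL (lam : Multiset ℕ) : Fin (Multiset.card lam) → ℕ :=
  fun i => (lam.sort (· ≤ ·)).reverse.getD i 0

theorem LL_map (lam : Multiset ℕ) : Finset.univ.val.map (LL lam) = lam := map_getD_rev lam

theorem LL_sum (lam : Multiset ℕ) : ∑ i, LL lam i = lam.sum := by
  conv_rhs => rw [← LL_map lam]
  rfl

theorem sval_expand (lam : Multiset ℕ) : sval lam =
    ∑ σ : Equiv.Perm (Fin (Multiset.card lam)), (Equiv.Perm.sign σ : ℤ) •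
      (if (∀ i : Fin (Multiset.card lam), (i : ℕ) ≤ LL lam i + (σ i : ℕ)) then
        hM (jt (LL lam) σ) else 0) := by
  funext nu
  rw [Finset.sum_apply]
  apply Finset.sum_congr rfl
  intro σ _
  rw [Pi.smul_apply, zsmul_eq_mul]
  congr 1
  split_ifs with h1 h2
  · rfl
  · exact absurd h1 h2
  · rename_i h2
    exact absurd h2 h1
  · rfl

theorem jt_one (lam : Multiset ℕ) (hp : ∀ x ∈ lam, 0 < x) : jt (LL lam) 1 = lam := by
  unfold jt
  simp only [Equiv.Perm.one_apply, Nat.add_sub_cancel]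
  rw [show (fun i => LL lam i) = LL lam from rfl, LL_map, Multiset.filter_eq_self]
  exact fun a ha => (hp a ha).ne'

theorem sval_sub_mem {n : ℕ} (lam : Nat.Partition n) : sval lam.parts - hM lam.parts ∈
    Submodule.span ℤ {f | ∃ mu : Nat.Partition n, sqM lam.parts < sqM mu.parts ∧
      f = hM mu.parts} := by
  rw [sval_expand, ← Finset.add_sum_erase _ _ (Finset.mem_univ 1)]
  rw [if_pos (by intro i; rw [Equiv.Perm.one_apply]; omega),
    jt_one _ (fun x hx => lam.parts_pos hx)]
  rw [Equiv.Perm.sign_one, Units.val_one, one_smul, add_sub_cancel_left]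
  apply Submodule.sum_mem
  intro σ hσ
  apply Submodule.smul_mem
  split_ifs with hok
  · apply Submodule.subset_span
    refine ⟨⟨jt (LL lam.parts) σ, ?_, ?_⟩, ?_, rfl⟩
    · intro i hi
      unfold jt at hi
      rw [Multiset.mem_filter] at hi
      omega
    · rw [jt_sum _ _ hok, LL_sum, lam.parts_sum]
    · have := jt_sq (LL lam.parts) (fun i j h => rev_antitone _ i j h) σ hok
        (Finset.ne_of_mem_erase hσ)
      rwa [LL_map] at this
  · exact Submodule.zero_mem _

theorem sval_mem {n : ℕ} (lam : Nat.Partition n) : sval lam.parts ∈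
    Submodule.span ℤ (Set.range (fun mu : Nat.Partition n => hM mu.parts)) := by
  rw [← sub_add_cancel (sval lam.parts) (hM lam.parts)]
  apply Submodule.add_mem
  · refine Submodule.span_mono ?_ (sval_sub_mem lam)
    rintro f ⟨mu, _, rfl⟩
    exact ⟨mu, rfl⟩
  · exact Submodule.subset_span ⟨lam, rfl⟩

theorem hM_mem {n : ℕ} (lam : Nat.Partition n) : hM lam.parts ∈
    Submodule.span ℤ (Set.range (fun mu : Nat.Partition n => sval mu.parts)) := by
  let r : Nat.Partition n → Nat.Partition n → Prop := fun a b => sqM b.parts < sqM a.parts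
  have : IsTrans _ r := ⟨fun a b c h1 h2 => lt_trans h2 h1⟩
  have : Std.Irrefl r := ⟨fun a => lt_irrefl _⟩
  have wf : WellFounded r := Finite.wellFounded_of_trans_of_irrefl r
  induction lam using wf.induction with
  | _ lam ih =>
    rw [← sub_sub_cancel (sval lam.parts) (hM lam.parts)]
    apply Submodule.sub_mem
    · exact Submodule.subset_span ⟨lam, rfl⟩
    · refine Submodule.span_le.2 ?_ (sval_sub_mem lam)
      rintro f ⟨mu, h, rfl⟩
      exact ih mu h

theorem sval_zero {lam mu : Multiset ℕ} (h : mu.sum ≠ lam.sum) : sval lam mu = 0 := by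
  rw [sval_expand, Finset.sum_apply]
  apply Finset.sum_eq_zero
  intro σ _
  split_ifs with hok
  · rw [Pi.smul_apply]
    have : hM (jt (LL lam) σ) mu = 0 := by
      unfold hM
      rw [Nat.cast_eq_zero]
      by_contra hne
      apply h
      rw [Mcount_sum hne, jt_sum _ _ hok, LL_sum]
    rw [this, smul_zero]
  · simp

theorem H_indep (n : ℕ) :
    LinearIndependent ℚ (fun (lam mu : Nat.Partition n) => hM lam.parts mu.parts) := by
  rw [Fintype.linearIndependent_iff]
  intro c hc
  by_contra hne
  push Not at hne
  have : (Finset.univ.filter (fun i => c i ≠ 0)).Nonempty := by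
    obtain ⟨i, hi⟩ := hne
    exact ⟨i, by simpa using hi⟩
  obtain ⟨l0, hl0, hmin⟩ := Finset.exists_min_image _
    (fun lam : Nat.Partition n => Multiset.card lam.parts) this
  simp only [Finset.mem_filter, Finset.mem_univ, true_and] at hl0 hmin
  have h1 := congrFun hc l0
  rw [Finset.sum_apply, Finset.sum_eq_single l0] at h1
  · simp only [Pi.smul_apply, smul_eq_mul, Pi.zero_apply, mul_eq_zero] at h1
    rcases h1 with h1 | h1
    · exact hl0 h1
    · exact Mcount_self _ (Nat.cast_eq_zero.1 h1)
  · intro l _ hl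
    rw [Pi.smul_apply, smul_eq_mul]
    by_contra h2
    have h3 := left_ne_zero_of_mul h2
    have h4 := right_ne_zero_of_mul h2
    unfold hM at h4
    rw [Nat.cast_ne_zero] at h4
    obtain ⟨h5, h6⟩ := Mcount_card h4 (fun x hx => l.parts_pos hx)
    exact hl (Nat.Partition.ext (h6 (le_antisymm h5 (hmin l h3))))
  · intro h
    exact absurd (Finset.mem_univ _) h

/-- The character table of the symmetric group is invertible. -/
theorem sval_inv (n : ℕ) : ∃ U : Matrix (Nat.Partition n) (Nat.Partition n) ℚ,
    ∀ lam nu : Nat.Partition n,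
      ∑ mu : Nat.Partition n, sval lam.parts mu.parts * U mu nu = if lam = nu then 1 else 0 := by
  let S : Matrix (Nat.Partition n) (Nat.Partition n) ℚ := fun lam mu => sval lam.parts mu.parts
  have hspan : ⊤ ≤ Submodule.span ℚ (Set.range S.row) := by
    have h1 : Submodule.span ℚ (Set.range
        (fun (lam mu : Nat.Partition n) => hM lam.parts mu.parts)) = ⊤ :=
      (H_indep n).span_eq_top_of_card_eq_finrank' (by simp)
    rw [← h1, Submodule.span_le]
    rintro f ⟨lam, rfl⟩
    obtain ⟨c, hc⟩ := (Submodule.mem_span_range_iff_exists_fun ℤ).1 (hM_mem lam)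
    have : (fun mu : Nat.Partition n => hM lam.parts mu.parts) =
        ∑ nu, (c nu : ℚ) • S.row nu := by
      funext mu
      rw [← hc, Finset.sum_apply, Finset.sum_apply]
      apply Finset.sum_congr rfl
      intro nu _
      simp [S, Matrix.row]
    show (fun mu : Nat.Partition n => hM lam.parts mu.parts) ∈ _
    rw [this]
    exact Submodule.sum_mem _ (fun nu _ => Submodule.smul_mem _ _ (Submodule.subset_span ⟨nu, rfl⟩))
  have hli := linearIndependent_of_top_le_span_of_card_eq_finrank hspan (by simp)
  rw [Matrix.linearIndependent_rows_iff_isUnit] at hli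
  obtain ⟨U, hU⟩ := hli.exists_right_inv
  refine ⟨U, fun lam nu => ?_⟩
  have := congrFun (congrFun hU lam) nu
  rw [Matrix.mul_apply, Matrix.one_apply] at this
  exact this

end SV

section ML
variable {G : Type*} [Group G] [Fintype G] {η η' : Type*} [Fintype η] [Fintype η']

theorem zetaTuple_multilinear (ws : η → ℕ) {w : ℕ} (h : ∑ i, ws i = w) (φ : η → G → ℚ)
    {K : η → Type*} [∀ i, Fintype (K i)] (c : ∀ i, K i → ℤ)
    (f : ∀ i, K i → Equiv.Perm (Fin (ws i)) → ℚ) :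
    zetaTuple ws h φ (fun i => ∑ k, c i k • f i k) =
      ∑ κ : (∀ i, K i), (∏ i, c i (κ i)) • zetaTuple ws h φ (fun i => f i (κ i)) := by
  funext g
  rw [Finset.sum_apply]
  unfold zetaTuple IndFun
  have h1 : ∀ k : (∀ i, Wr G (ws i)),
      ∏ i, tilprod (φ i) (k i) * (∑ k, c i k • f i k) (k i).2 =
      ∑ κ : (∀ i, K i), ((∏ i, c i (κ i) : ℤ) : ℚ) *
        ∏ i, tilprod (φ i) (k i) * f i (κ i) (k i).2 := by
    intro k
    have : ∀ i, tilprod (φ i) (k i) * (∑ k, c i k • f i k) (k i).2 =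
        ∑ m : K i, (c i m : ℚ) * (tilprod (φ i) (k i) * f i m (k i).2) := by
      intro i
      rw [Finset.sum_apply, Finset.mul_sum]
      apply Finset.sum_congr rfl
      intro m _
      rw [Pi.smul_apply, zsmul_eq_mul]
      ring
    rw [Finset.prod_congr rfl (fun i _ => this i), Finset.prod_univ_sum, Fintype.piFinset_univ]
    apply Finset.sum_congr rfl
    intro κ _
    rw [Finset.prod_mul_distrib]
    push_cast
    rfl
  have h3 : ∀ (x : Wr G w) (k : ∀ i, Wr G (ws i)), (if embWr ws h k = x * g * x⁻¹ then
      ∏ i, tilprod (φ i) (k i) * (∑ k, c i k • f i k) (k i).2 else 0) =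
      ∑ κ : (∀ i, K i), ((∏ i, c i (κ i) : ℤ) : ℚ) *
        if embWr ws h k = x * g * x⁻¹ then ∏ i, tilprod (φ i) (k i) * f i (κ i) (k i).2 else 0 := by
    intro x k
    split_ifs
    · exact h1 k
    · simp
  refine (congrArg _ (Finset.sum_congr rfl
    (fun x _ => Finset.sum_congr rfl (fun k _ => h3 x k)))).trans ?_
  simp only [Pi.smul_apply, zsmul_eq_mul]
  simp only [Finset.mul_sum]
  rw [Finset.sum_congr rfl (fun x _ => Finset.sum_comm), Finset.sum_comm]
  apply Finset.sum_congr rfl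
  intro κ _
  apply Finset.sum_congr rfl
  intro x _
  apply Finset.sum_congr rfl
  intro k _
  ring

theorem zetaTuple_mem_of (ws : η → ℕ) {w : ℕ} (h : ∑ i, ws i = w) (φ : η → G → ℚ)
    {K : η → Type*} [∀ i, Fintype (K i)]
    (f : ∀ i, K i → Equiv.Perm (Fin (ws i)) → ℚ) (fs : ∀ i, Equiv.Perm (Fin (ws i)) → ℚ)
    (hfs : ∀ i, fs i ∈ Submodule.span ℤ (Set.range (f i)))
    (N : Submodule ℤ (Wr G w → ℚ))
    (hN : ∀ κ : (∀ i, K i), zetaTuple ws h φ (fun i => f i (κ i)) ∈ N) :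
    zetaTuple ws h φ fs ∈ N := by
  have : ∀ i, ∃ c : K i → ℤ, ∑ k, c k • f i k = fs i :=
    fun i => (Submodule.mem_span_range_iff_exists_fun ℤ).1 (hfs i)
  choose c hc using this
  have : fs = fun i => ∑ k, c i k • f i k := funext (fun i => (hc i).symm)
  rw [this, zetaTuple_multilinear]
  exact Submodule.sum_mem _ (fun κ _ => Submodule.smul_mem _ _ (hN κ))

/-- `h_λ` as a function on the symmetric group -/
def hFun {n : ℕ} (lam : Nat.Partition n) : Equiv.Perm (Fin n) → ℚ := fun g => hM lam.parts (cycM g)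

theorem hFun_mem {n : ℕ} (lam : Nat.Partition n) : hFun lam ∈
    Submodule.span ℤ (Set.range (fun mu : Nat.Partition n => sFun mu)) := by
  obtain ⟨c, hc⟩ := (Submodule.mem_span_range_iff_exists_fun ℤ).1 (hM_mem lam)
  refine (Submodule.mem_span_range_iff_exists_fun ℤ).2 ⟨c, ?_⟩
  funext g
  have := congrFun hc (cycM g)
  rw [Finset.sum_apply] at this ⊢
  exact this

theorem virt_mem {n : ℕ} {f : Equiv.Perm (Fin n) → ℚ} (hf : f ∈ VirtCharS n) : f ∈
    Submodule.span ℤ (Set.range (fun mu : Nat.Partition n => hFun mu)) := by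
  refine Submodule.span_le.2 ?_ hf
  rintro _ ⟨lam, rfl⟩
  obtain ⟨c, hc⟩ := (Submodule.mem_span_range_iff_exists_fun ℤ).1 (sval_mem lam)
  refine (Submodule.mem_span_range_iff_exists_fun ℤ).2 ⟨c, ?_⟩
  funext g
  have := congrFun hc (cycM g)
  rw [Finset.sum_apply] at this ⊢
  exact this

theorem Tval_reindex {J : Type*} [Fintype J] (e : η ≃ η') (φ : η → G → ℚ)
    (F : η → Multiset ℕ → ℚ) (len : J → ℕ) (v : J → G) :
    ∑ c : J → η, Tval φ F len v c =
      ∑ c : J → η', Tval (fun i => φ (e.symm i)) (fun i => F (e.symm i)) len v c := by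
  apply Fintype.sum_equiv (Equiv.arrowCongr (Equiv.refl _) e)
  intro c
  unfold Tval
  congr 1
  · simp
  · apply Fintype.prod_equiv e
    intro i
    simp

theorem zetaTuple_reindex (e : η ≃ η') (ws : η → ℕ) {w : ℕ} (h : ∑ i, ws i = w)
    (h' : ∑ i, ws (e.symm i) = w)
    (φ : η → G → ℚ) (hφ : ∀ i, ∀ x g : G, φ i (x * g * x⁻¹) = φ i g)
    (F : η → Multiset ℕ → ℚ) (hF : ∀ i M, M.sum ≠ ws i → F i M = 0)
    (fs : ∀ i, Equiv.Perm (Fin (ws i)) → ℚ) (hfs : ∀ i σ, fs i σ = F i (cycM σ)) :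
    zetaTuple ws h φ fs = zetaTuple (fun i => ws (e.symm i)) h' (fun i => φ (e.symm i))
      (fun i => fs (e.symm i)) := by
  funext g
  rw [zetaTuple_eq ws h φ hφ F hF fs hfs g _ (isTr_basepoints g.2)]
  rw [zetaTuple_eq (fun i => ws (e.symm i)) h' (fun i => φ (e.symm i)) (fun i => hφ _)
    (fun i => F (e.symm i)) (fun i => hF _)
    (fun i => fs (e.symm i)) (fun i => hfs _) g _ (isTr_basepoints g.2)]
  exact Tval_reindex e φ F _ _

theorem zetaP_mem (X : AddSubgroup (G → ℚ)) (w : ℕ)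
    (hXcf : ∀ f ∈ X, ∀ x g : G, f (x * g * x⁻¹) = f g) (b : η → (G → ℚ))
    (hb : ∀ t, b t ∈ X) (lam : {l : η → PttAll // ∑ t, (l t).1 = w}) :
    zetaP b lam ∈ wreathSpan G w X := by
  apply AddSubgroup.subset_closure
  refine ⟨Fintype.card η, fun i => (lam.1 ((Fintype.equivFin η).symm i)).1, ?_,
    fun i => b ((Fintype.equivFin η).symm i), fun i => sFun (lam.1 ((Fintype.equivFin η).symm i)).2,
    fun i => hb _, fun i => Submodule.subset_span ⟨_, rfl⟩, ?_⟩
  · rw [Equiv.sum_comp (Fintype.equivFin η).symm (fun i => (lam.1 i).1)]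
    exact lam.2
  · refine zetaTuple_reindex (Fintype.equivFin η) (fun t => (lam.1 t).1) lam.2 _ b
      (fun i => hXcf _ (hb i)) (fun t => sval (lam.1 t).2.parts) ?_ (fun t => sFun (lam.1 t).2)
      (fun _ _ => rfl)
    intro i M hM
    apply sval_zero
    rw [(lam.1 i).2.parts_sum]
    exact hM

end ML

section TE
variable {G : Type*} [Group G]

theorem rot_pow (m : ℕ) (k : ℕ) : ((finRotate (m + 1)) ^ k) 0 = (Fin.ofNat (m + 1) k) := by
  induction k with
  | zero => simp
  | succ k ih =>
    rw [pow_succ', Equiv.Perm.mul_apply, ih, finRotate_apply]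
    simp [Fin.ext_iff, Fin.val_add]

theorem single_cycle (k : ℕ) (hk : 0 < k) (a : G) : ∃ (g : Wr G k) (s : Fin k),
    IsTr g.2 (fun _ : Unit => s) ∧ clen g.2 s = k ∧ cycleProd g.1 g.2 s = a := by
  obtain ⟨m, rfl⟩ : ∃ m, k = m + 1 := ⟨k - 1, by omega⟩
  have hsc : ∀ i, (finRotate (m + 1)).SameCycle 0 i := by
    intro i
    refine ⟨(i : ℕ), ?_⟩
    rw [zpow_natCast, rot_pow]
    simp
  have hcl : clen (finRotate (m + 1)) 0 = m + 1 := by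
    unfold clen
    simp [hsc]
  refine ⟨((fun i => if i = 0 then a else 1), finRotate (m + 1)), 0, ⟨?_, ?_⟩, hcl, ?_⟩
  · intro i
    exact ⟨(), hsc i⟩
  · intro _ _ _
    rfl
  · rw [cycleProd_eq]
    show ((List.range (clen (finRotate (m + 1)) 0)).map
      (fun k => if ((finRotate (m + 1))⁻¹ ^ k) 0 = 0 then a else 1)).prod = a
    rw [hcl, List.range_succ_eq_map, List.map_cons, List.prod_cons, List.map_map]
    have : List.map ((fun k => if ((finRotate (m + 1))⁻¹ ^ k) 0 = 0 then a else 1) ∘ Nat.succ)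
        (List.range m) = List.map (fun _ => 1) (List.range m) := by
      apply List.map_congr_left
      intro k hk
      rw [List.mem_range] at hk
      rw [Function.comp_apply, if_neg]
      intro h0
      rw [inv_pow, Equiv.Perm.inv_eq_iff_eq, rot_pow, Fin.ext_iff] at h0
      have h0 : 0 % (m + 1) = (k + 1) % (m + 1) := h0
      rw [Nat.mod_eq_of_lt (a := k + 1) (by omega)] at h0
      simp at h0
    rw [this]
    simp

theorem test_element {J : Type*} [Fintype J] (k : J → ℕ) (hk : ∀ j, 0 < k j) {w : ℕ}
    (hw : ∑ j, k j = w) (a : J → G) : ∃ (g : Wr G w) (s : J → Fin w),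
    IsTr g.2 s ∧ (∀ j, clen g.2 (s j) = k j) ∧ ∀ j, cycleProd g.1 g.2 (s j) = a j := by
  choose g s h1 h2 h3 using fun j => single_cycle (k j) (hk j) (a j)
  have h4 := embWr_isTr k hw g (J := fun _ => Unit) (fun j _ => s j) h1
  refine ⟨embWr k hw g, fun j => embSigma k hw ⟨j, s j⟩, ⟨?_, ?_⟩, ?_, ?_⟩
  · intro i
    obtain ⟨p, hp⟩ := h4.ex i
    exact ⟨p.1, hp⟩
  · intro j j' hj
    have := h4.uniq ⟨j, ()⟩ ⟨j', ()⟩ hj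
    exact congrArg Sigma.fst this
  · intro j
    rw [embWr_clen, h2]
  · intro j
    rw [embWr_cycleProd, h3]

variable [Fintype G] {β : Type*} [Fintype β]

theorem exists_dual (b : β → G → ℚ) (hb : LinearIndependent ℤ b) :
    ∃ d : β → G → ℚ, ∀ t s, ∑ a, d t a * b s a = if t = s then 1 else 0 := by
  have hb' : LinearIndependent ℚ b := (LinearIndependent.iff_fractionRing ℤ ℚ).1 hb
  obtain ⟨L, hL⟩ := LinearMap.exists_leftInverse_of_injective
    (Fintype.linearCombination ℚ b) (by
      exact LinearMap.ker_eq_bot.2 hb'.fintypeLinearCombination_injective)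
  refine ⟨fun t a => L (Pi.single a 1) t, fun t s => ?_⟩
  have h1 : L (b s) = Pi.single s 1 := by
    have := LinearMap.congr_fun hL (Pi.single s 1)
    simpa [Fintype.linearCombination_apply_single] using this
  have h2 : b s = ∑ a, b s a • (Pi.single a 1 : G → ℚ) := by
    funext x
    simp [Finset.sum_apply, Pi.single_apply]
  have h3 := congrFun h1 t
  rw [h2, map_sum, Finset.sum_apply, Pi.single_apply] at h3
  rw [← h3]
  apply Finset.sum_congr rfl
  intro a _
  rw [map_smul, Pi.smul_apply, smul_eq_mul, mul_comm]

theorem test_pairing {J : Type*} [Fintype J] (b d : β → G → ℚ)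
    (hd : ∀ t s, ∑ a, d t a * b s a = if t = s then 1 else 0)
    (F : β → Multiset ℕ → ℚ) (len : J → ℕ) (c0 : J → β) :
    ∑ a : J → G, (∏ j, d (c0 j) (a j)) * ∑ c : J → β, Tval b F len a c =
      ∏ t, F t ((Finset.univ.filter (fun j => c0 j = t)).val.map len) := by
  simp only [Finset.mul_sum]
  rw [Finset.sum_comm]
  have h1 : ∀ c : J → β, ∑ a : J → G, (∏ j, d (c0 j) (a j)) * Tval b F len a c =
      (if c0 = c then 1 else 0) *
        ∏ t, F t ((Finset.univ.filter (fun j => c j = t)).val.map len) := by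
    intro c
    unfold Tval
    simp only [← mul_assoc]
    rw [← Finset.sum_mul]
    congr 1
    simp only [← Finset.prod_mul_distrib]
    have := (Finset.prod_univ_sum (fun _ : J => (Finset.univ : Finset G))
      (fun j a => d (c0 j) a * b (c j) a)).symm
    rw [Fintype.piFinset_univ] at this
    rw [this]
    simp only [hd]
    split_ifs with h
    · subst h
      simp
    · obtain ⟨j, hj⟩ := Function.ne_iff.1 h
      exact Finset.prod_eq_zero (Finset.mem_univ j) (if_neg hj)
  simp only [h1]
  simp

theorem zetaP_eq (b : β → G → ℚ) (hb : ∀ i, ∀ x g : G, b i (x * g * x⁻¹) = b i g) {w : ℕ}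
    (lam : {l : β → PttAll // ∑ t, (l t).1 = w}) {J : Type*} [Fintype J]
    (g : Wr G w) (s : J → Fin w) (hs : IsTr g.2 s) :
    zetaP b lam g = ∑ c : J → β, Tval b (fun t => sval (lam.1 t).2.parts)
      (fun j => clen g.2 (s j)) (fun j => cycleProd g.1 g.2 (s j)) c := by
  refine zetaTuple_eq _ lam.2 b hb (fun t => sval (lam.1 t).2.parts) ?_ _ (fun _ _ => rfl) g s hs
  intro i M hM
  apply sval_zero
  rw [(lam.1 i).2.parts_sum]
  exact hM

theorem exists_functional_aux (b : β → G → ℚ) (hb : ∀ i, ∀ x g : G, b i (x * g * x⁻¹) = b i g)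
    (hb1 : LinearIndependent ℤ b) {w : ℕ} {J : Type*} [Fintype J] (k : J → ℕ)
    (hk : ∀ j, 0 < k j) (hw : ∑ j, k j = w) (c0 : J → β) :
    ∃ D : (Wr G w → ℚ) →ₗ[ℚ] ℚ, ∀ lam : {l : β → PttAll // ∑ t, (l t).1 = w},
      D (zetaP b lam) = ∏ t, sval (lam.1 t).2.parts
        ((Finset.univ.filter (fun j => c0 j = t)).val.map k) := by
  obtain ⟨d, hd⟩ := exists_dual b hb1
  choose g s h1 h2 h3 using fun a => test_element (G := G) k hk hw a
  refine ⟨∑ a : J → G, (∏ j, d (c0 j) (a j)) • LinearMap.proj (g a), fun lam => ?_⟩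
  rw [LinearMap.sum_apply]
  have h4 : ∀ a : J → G, ((∏ j, d (c0 j) (a j)) •
      (LinearMap.proj (g a) : (Wr G w → ℚ) →ₗ[ℚ] ℚ)) (zetaP b lam) =
      (∏ j, d (c0 j) (a j)) * ∑ c, Tval b (fun t => sval (lam.1 t).2.parts) k a c := by
    intro a
    rw [LinearMap.smul_apply, LinearMap.proj_apply, smul_eq_mul,
      zetaP_eq b hb lam (g a) (s a) (h1 a)]
    have e2 : (fun j => clen (g a).2 (s a j)) = k := funext (h2 a)
    have e3 : (fun j => cycleProd (g a).1 (g a).2 (s a j)) = a := funext (h3 a)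
    rw [e2, e3]
  rw [Finset.sum_congr rfl (fun a _ => h4 a)]
  exact test_pairing b d hd _ k c0

/-- extracting `∏_t s_{λ(t)}(μ(t))` by a linear functional -/
theorem exists_functional (b : β → G → ℚ) (hb : ∀ i, ∀ x g : G, b i (x * g * x⁻¹) = b i g)
    (hb1 : LinearIndependent ℤ b) {w : ℕ} (n : β → ℕ) (hn : ∑ t, n t = w)
    (mu : ∀ t, Nat.Partition (n t)) :
    ∃ D : (Wr G w → ℚ) →ₗ[ℚ] ℚ, ∀ lam : {l : β → PttAll // ∑ t, (l t).1 = w},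
      D (zetaP b lam) = ∏ t, sval (lam.1 t).2.parts (mu t).parts := by
  let k : (Σ t, Fin (Multiset.card (mu t).parts)) → ℕ := fun j => LL (mu j.1).parts j.2
  have hk : ∀ j, 0 < k j := by
    intro j
    apply (mu j.1).parts_pos
    have := Multiset.mem_map_of_mem (LL (mu j.1).parts) (Finset.mem_univ_val j.2)
    rwa [LL_map] at this
  have hw : ∑ j, k j = w := by
    rw [Fintype.sum_sigma, ← hn]
    apply Finset.sum_congr rfl
    intro t _
    exact (LL_sum _).trans (mu t).parts_sum
  obtain ⟨D, hD⟩ := exists_functional_aux b hb hb1 k hk hw (fun j => j.1)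
  refine ⟨D, fun lam => (hD lam).trans ?_⟩
  apply Finset.prod_congr rfl
  intro t _
  congr 1
  rw [filter_sigma_map]
  exact LL_map _

theorem zetaP_indep (b : β → G → ℚ) (hb : ∀ i, ∀ x g : G, b i (x * g * x⁻¹) = b i g)
    (hb1 : LinearIndependent ℤ b) (w : ℕ) :
    LinearIndependent ℤ (fun lam : {l : β → PttAll // ∑ t, (l t).1 = w} => zetaP b lam) := by
  rw [linearIndependent_iff']
  intro S m hm l0 hl0
  choose D hD using fun mu => exists_functional b hb hb1 (fun t => (l0.1 t).1) l0.2 mu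
  choose U hU using fun n => sval_inv n
  let E : (Wr G w → ℚ) →ₗ[ℚ] ℚ := ∑ mu : (∀ t, Nat.Partition (l0.1 t).1),
    (∏ t, U _ (mu t) (l0.1 t).2) • D mu
  have hE : ∀ lam, E (zetaP b lam) = if lam = l0 then 1 else 0 := by
    intro lam
    simp only [E, LinearMap.sum_apply, LinearMap.smul_apply, hD, smul_eq_mul]
    simp only [← Finset.prod_mul_distrib]
    have h1 := (Finset.prod_univ_sum
      (fun t : β => (Finset.univ : Finset (Nat.Partition (l0.1 t).1)))
      (fun t mu => U _ mu (l0.1 t).2 * sval (lam.1 t).2.parts mu.parts)).symm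
    rw [Fintype.piFinset_univ] at h1
    rw [h1]
    have h2 : ∀ t, ∑ mu : Nat.Partition (l0.1 t).1,
        U _ mu (l0.1 t).2 * sval (lam.1 t).2.parts mu.parts =
        if lam.1 t = l0.1 t then 1 else 0 := by
      intro t
      generalize lam.1 t = p
      generalize l0.1 t = q
      obtain ⟨n, p⟩ := p
      obtain ⟨m, q⟩ := q
      by_cases hnm : n = m
      · subst hnm
        rw [Finset.sum_congr rfl (fun mu _ => mul_comm _ _), hU]
        simp
      · rw [if_neg (by intro h; exact hnm (congrArg Sigma.fst h))]
        apply Finset.sum_eq_zero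
        intro mu _
        rw [sval_zero, mul_zero]
        rw [mu.parts_sum, p.parts_sum]
        exact fun h => hnm h.symm
    rw [Finset.prod_congr rfl (fun t _ => h2 t)]
    split_ifs with h
    · subst h
      simp
    · have : lam.1 ≠ l0.1 := fun h' => h (Subtype.ext h')
      obtain ⟨t, ht⟩ := Function.ne_iff.1 this
      exact Finset.prod_eq_zero (Finset.mem_univ t) (if_neg ht)
  have h5 := congrArg E hm
  rw [map_sum, map_zero] at h5
  have h6 : ∀ lam ∈ S, E (m lam • zetaP b lam) = if lam = l0 then (m lam : ℚ) else 0 := by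
    intro lam _
    rw [map_zsmul, hE, zsmul_eq_mul]
    simp
  rw [Finset.sum_congr rfl h6, Finset.sum_ite_eq' S l0, if_pos hl0] at h5
  exact_mod_cast h5

end TE

section ZS
variable {G : Type*} {η J I I' : Type*} [Fintype η] [Fintype J] [Fintype I] [Fintype I']

/-- the sum over colourings with prescribed fibre sums -/
def zsum (φ : I → G → ℚ) (a : I → ℕ) (len : J → ℕ) (v : J → G) : ℚ :=
  ∑ c : J → I, if FS len a c then ∏ j, φ (c j) (v j) else 0

theorem zsum_reindex (e : I ≃ I') (φ : I → G → ℚ) (a : I → ℕ) (len : J → ℕ) (v : J → G) :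
    zsum φ a len v = zsum (fun i => φ (e.symm i)) (fun i => a (e.symm i)) len v := by
  unfold zsum
  apply Fintype.sum_equiv (Equiv.arrowCongr (Equiv.refl _) e)
  intro c
  have : FS len a c ↔ FS len (fun i => a (e.symm i)) ((Equiv.arrowCongr (Equiv.refl _) e) c) := by
    unfold FS
    rw [← e.forall_congr_right]
    apply forall_congr'
    intro k
    simp
  rw [if_congr this rfl rfl]
  simp

theorem Tval_zsum (φ : η → G → ℚ) (len : J → ℕ) (v : J → G) (p : I → η) (a : I → ℕ) :
    ∑ c : J → η, Tval φ (fun i M => (Mcount ((Finset.univ.filter (fun k => p k = i)).val.map a) M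
      : ℚ)) len v c = zsum (fun i => φ (p i)) a len v :=
  Tval_Mcount φ len v p a

theorem zsum_zero (φ : I → G → ℚ) (a : I → ℕ) (len : J → ℕ) (v : J → G)
    (h : ∑ j, len j ≠ ∑ i, a i) : zsum φ a len v = 0 := by
  apply Finset.sum_eq_zero
  intro c _
  rw [if_neg]
  intro hc
  apply h
  rw [← Finset.sum_fiberwise Finset.univ c]
  exact Finset.sum_congr rfl (fun i _ => hc i)

end ZS

section OP
variable {G Γ α : Type*} [Fintype α] (len : Γ → α → ℕ) (vl : Γ → α → G)

/-- summand of the operator -/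
def Hsum (n : ℕ) (φ : G → ℚ) (F : Γ → Finset α → ℚ) (g : Γ) (S : Finset α) : ℚ :=
  ∑ U ∈ S.powerset, if ∑ z ∈ U, len g z = n then
    (∏ z ∈ U, φ (vl g z)) * F g (S \ U) else 0

/-- the operators `H n φ` -/
def Hop (n : ℕ) (φ : G → ℚ) : Module.End ℤ (Γ → Finset α → ℚ) where
  toFun F := Hsum len vl n φ F
  map_add' F F' := by
    funext g S
    simp only [Hsum, Pi.add_apply]
    rw [← Finset.sum_add_distrib]
    apply Finset.sum_congr rfl
    intro U _
    split_ifs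
    · ring
    · simp
  map_smul' m F := by
    funext g S
    simp only [Hsum, Pi.smul_apply, RingHom.id_apply, zsmul_eq_mul, Finset.mul_sum]
    apply Finset.sum_congr rfl
    intro U _
    split_ifs
    · ring
    · simp

theorem Hop_apply (n : ℕ) (φ : G → ℚ) (F : Γ → Finset α → ℚ) (g : Γ) (S : Finset α) :
    Hop len vl n φ F g S = ∑ U ∈ S.powerset, if ∑ z ∈ U, len g z = n then
    (∏ z ∈ U, φ (vl g z)) * F g (S \ U) else 0 := rfl

theorem Hop_zero_left (hlen : ∀ g z, 0 < len g z) (φ : G → ℚ) : Hop len vl 0 φ = 1 := by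
  ext F g S
  rw [Hop_apply, Finset.sum_eq_single ∅]
  · simp
  · intro U _ hU
    rw [if_neg]
    obtain ⟨z, hz⟩ := Finset.nonempty_iff_ne_empty.2 hU
    intro h0
    rw [Finset.sum_eq_zero_iff] at h0
    exact (hlen g z).ne' (h0 z hz)
  · intro h
    simp at h

theorem Hop_zero_right (n : ℕ) (hn : n ≠ 0) : Hop len vl n (0 : G → ℚ) = 0 := by
  ext F g S
  rw [Hop_apply]
  apply Finset.sum_eq_zero
  intro U _
  split_ifs with h
  · have : U.Nonempty := by
      rw [Finset.nonempty_iff_ne_empty]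
      rintro rfl
      simp at h
      exact hn h.symm
    obtain ⟨z, hz⟩ := this
    rw [Finset.prod_eq_zero hz rfl, zero_mul]
  · rfl

theorem Hop_add (n : ℕ) (φ ψ : G → ℚ) : Hop len vl n (φ + ψ) =
    ∑ p ∈ Finset.HasAntidiagonal.antidiagonal n, Hop len vl p.1 φ * Hop len vl p.2 ψ := by
  ext F g S
  have hR : (∑ p ∈ Finset.HasAntidiagonal.antidiagonal n, Hop len vl p.1 φ * Hop len vl p.2 ψ) F g S =
      ∑ T ∈ S.powerset, ∑ R ∈ (S \ T).powerset,
        if ∑ z ∈ T, len g z + ∑ z ∈ R, len g z = n then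
          (∏ z ∈ T, φ (vl g z)) * (∏ z ∈ R, ψ (vl g z)) * F g ((S \ T) \ R) else 0 := by
    rw [LinearMap.sum_apply, Finset.sum_apply, Finset.sum_apply]
    simp only [Module.End.mul_apply, Hop_apply]
    rw [Finset.sum_comm]
    apply Finset.sum_congr rfl
    intro T _
    have h1 : ∀ p ∈ Finset.HasAntidiagonal.antidiagonal n, (if ∑ z ∈ T, len g z = p.1 then
        (∏ z ∈ T, φ (vl g z)) * ∑ R ∈ (S \ T).powerset, (if ∑ z ∈ R, len g z = p.2 then
          (∏ z ∈ R, ψ (vl g z)) * F g ((S \ T) \ R) else 0) else 0) =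
        ∑ R ∈ (S \ T).powerset, if p = (∑ z ∈ T, len g z, ∑ z ∈ R, len g z) then
          (∏ z ∈ T, φ (vl g z)) * (∏ z ∈ R, ψ (vl g z)) * F g ((S \ T) \ R) else 0 := by
      intro p _
      obtain ⟨p1, p2⟩ := p
      simp only [Prod.mk.injEq]
      by_cases h : ∑ z ∈ T, len g z = p1
      · rw [if_pos h, Finset.mul_sum]
        apply Finset.sum_congr rfl
        intro R _
        by_cases h' : ∑ z ∈ R, len g z = p2
        · rw [if_pos h', if_pos ⟨h.symm, h'.symm⟩]
          ring
        · rw [if_neg h', if_neg (fun hh => h' hh.2.symm), mul_zero]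
      · rw [if_neg h]
        symm
        apply Finset.sum_eq_zero
        intro R _
        rw [if_neg (fun hh => h hh.1.symm)]
    rw [Finset.sum_congr rfl h1, Finset.sum_comm]
    apply Finset.sum_congr rfl
    intro R _
    rw [Finset.sum_ite_eq']
    simp only [Finset.HasAntidiagonal.mem_antidiagonal]
  rw [hR, Hop_apply]
  have hL : ∀ U ∈ S.powerset, (if ∑ z ∈ U, len g z = n then
      (∏ z ∈ U, (φ + ψ) (vl g z)) * F g (S \ U) else 0) =
      ∑ T ∈ U.powerset, if ∑ z ∈ U, len g z = n then
        (∏ z ∈ T, φ (vl g z)) * (∏ z ∈ U \ T, ψ (vl g z)) * F g (S \ U) else 0 := by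
    intro U _
    split_ifs
    · simp only [Pi.add_apply]
      rw [Finset.prod_add, Finset.sum_mul]
    · simp
  rw [Finset.sum_congr rfl hL, Finset.sum_sigma', Finset.sum_sigma']
  refine Finset.sum_bij' (fun x _ => ⟨x.2, x.1 \ x.2⟩) (fun x _ => ⟨x.1 ∪ x.2, x.1⟩) ?_ ?_ ?_ ?_ ?_
  · rintro ⟨U, T⟩ h
    simp only [Finset.mem_sigma, Finset.mem_powerset] at h ⊢
    exact ⟨h.2.trans h.1, Finset.sdiff_subset_sdiff h.1 (le_refl _)⟩
  · rintro ⟨T, R⟩ h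
    simp only [Finset.mem_sigma, Finset.mem_powerset] at h ⊢
    exact ⟨Finset.union_subset h.1 (h.2.trans Finset.sdiff_subset), Finset.subset_union_left⟩
  · rintro ⟨U, T⟩ h
    simp only [Finset.mem_sigma, Finset.mem_powerset] at h ⊢
    rw [Finset.union_sdiff_of_subset h.2]
  · rintro ⟨T, R⟩ h
    simp only [Finset.mem_sigma, Finset.mem_powerset] at h ⊢
    have : (T ∪ R) \ T = R := by
      rw [Finset.union_sdiff_left]
      exact Finset.sdiff_eq_self_of_disjoint
        (Finset.disjoint_of_subset_left h.2 Finset.sdiff_disjoint)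
    rw [this]
  · rintro ⟨U, T⟩ h
    simp only [Finset.mem_sigma, Finset.mem_powerset] at h ⊢
    have h1 : ∑ z ∈ U, len g z = ∑ z ∈ T, len g z + ∑ z ∈ U \ T, len g z := by
      rw [add_comm, Finset.sum_sdiff h.2]
    have h2 : (S \ T) \ (U \ T) = S \ U := by
      ext z
      have := @h.2 z
      simp only [Finset.mem_sdiff]
      tauto
    rw [h1, h2]

end OP

section LP
variable {G Γ α : Type*} [Fintype α] (len : Γ → α → ℕ) (vl : Γ → α → G)

/-- ordered set partitions -/
def IsPart {n : ℕ} (S : Finset α) (P : Fin n → Finset α) : Prop :=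
  (∀ z i j, z ∈ P i → z ∈ P j → i = j) ∧ ∀ z, z ∈ S ↔ ∃ i, z ∈ P i

theorem isPart_cons {n : ℕ} (S U : Finset α) (P : Fin n → Finset α) :
    IsPart S (Fin.cons U P : Fin (n + 1) → Finset α) ↔ U ⊆ S ∧ IsPart (S \ U) P := by
  unfold IsPart
  simp only [Fin.exists_fin_succ, Fin.cons_zero, Fin.cons_succ, Finset.mem_sdiff]
  constructor
  · rintro ⟨h1, h2⟩
    have h3 : ∀ z i, z ∈ U → z ∉ P i := by
      intro z i hz hi
      exact Fin.succ_ne_zero i (h1 z i.succ 0 (by simpa using hi) (by simpa using hz))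
    refine ⟨fun z hz => (h2 z).2 (Or.inl hz), ?_, ?_⟩
    · intro z i j hi hj
      exact Fin.succ_injective _ (h1 z i.succ j.succ (by simpa using hi) (by simpa using hj))
    · intro z
      rw [h2]
      constructor
      · rintro ⟨h | h, h'⟩
        · exact absurd h h'
        · exact h
      · rintro ⟨i, hi⟩
        exact ⟨Or.inr ⟨i, hi⟩, fun hz => h3 z i hz hi⟩
  · rintro ⟨h0, h1, h2⟩
    have h3 : ∀ z i, z ∈ U → z ∉ P i := fun z i hz hi => ((h2 z).2 ⟨i, hi⟩).2 hz
    refine ⟨?_, ?_⟩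
    · intro z i j
      refine Fin.cases ?_ (fun i => ?_) i <;> refine Fin.cases ?_ (fun j => ?_) j
      · intros; rfl
      · simp only [Fin.cons_zero, Fin.cons_succ]
        intro hz hi
        exact absurd hi (h3 z _ hz)
      · simp only [Fin.cons_zero, Fin.cons_succ]
        intro hi hz
        exact absurd hi (h3 z _ hz)
      · simp only [Fin.cons_succ]
        intro hi hj
        rw [h1 z i j hi hj]
    · intro z
      rw [← h2 z]
      constructor
      · intro hz
        by_cases hU : z ∈ U
        · exact Or.inl hU
        · exact Or.inr ⟨hz, hU⟩
      · rintro (h | h)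
        · exact h0 h
        · exact h.1

theorem isPart_consE {n : ℕ} (S U : Finset α) (P : Fin n → Finset α) :
    IsPart S ((Fin.consEquiv (fun _ : Fin (n + 1) => Finset α)) (U, P)) ↔
      U ⊆ S ∧ IsPart (S \ U) P :=
  isPart_cons S U P

/-- the starting function -/
def F0 : Γ → Finset α → ℚ := fun _ S => if S = ∅ then 1 else 0

theorem ofFn_prod_part (n : ℕ) (φ : Fin n → G → ℚ) (a : Fin n → ℕ) (g : Γ) (S : Finset α) :
    (List.ofFn (fun i => Hop len vl (a i) (φ i))).prod F0 g S =
      ∑ P : Fin n → Finset α, if IsPart S P ∧ ∀ i, ∑ z ∈ P i, len g z = a i then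
        ∏ i, ∏ z ∈ P i, φ i (vl g z) else 0 := by
  induction n generalizing S with
  | zero =>
    rw [Fintype.sum_unique]
    simp only [List.ofFn_zero, List.prod_nil, Module.End.one_apply, F0]
    have : ∀ P : Fin 0 → Finset α, S = ∅ ↔ IsPart S P := by
      intro P
      unfold IsPart
      simp [Finset.eq_empty_iff_forall_notMem]
    rw [if_congr (this _) rfl rfl]
    apply if_congr
    · exact ⟨fun h => ⟨h, fun i => i.elim0⟩, fun h => h.1⟩
    · simp
    · rfl
  | succ n ih =>
    rw [List.ofFn_succ, List.prod_cons, Module.End.mul_apply, Hop_apply]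
    rw [← Equiv.sum_comp (Fin.consEquiv (fun _ => Finset α)), Fintype.sum_prod_type]
    rw [← Finset.sum_subset (Finset.subset_univ S.powerset)]
    · apply Finset.sum_congr rfl
      intro U hU
      rw [Finset.mem_powerset] at hU
      rw [ih]
      simp only [isPart_consE, Fin.consEquiv_apply, Fin.forall_fin_succ, Fin.cons_zero,
        Fin.cons_succ, Fin.prod_univ_succ]
      split_ifs with h
      · rw [Finset.mul_sum]
        apply Finset.sum_congr rfl
        intro P _
        simp only [hU, h, true_and, mul_ite, mul_zero]
      · symm
        apply Finset.sum_eq_zero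
        intro P _
        rw [if_neg]
        tauto
    · intro U _ hU
      apply Finset.sum_eq_zero
      intro P _
      rw [if_neg]
      rintro ⟨h, _⟩
      apply hU
      rw [isPart_consE] at h
      exact Finset.mem_powerset.2 h.1

theorem ofFn_prod_zsum (n : ℕ) (φ : Fin n → G → ℚ) (a : Fin n → ℕ) (g : Γ) (S : Finset α) :
    (List.ofFn (fun i => Hop len vl (a i) (φ i))).prod F0 g S =
      zsum φ a (fun z : S => len g z) (fun z : S => vl g z) := by
  rw [ofFn_prod_part, zsum]
  symm
  refine @Fintype.sum_of_injective ℚ _ _ (@Pi.instFintype _ _ (fun a b => propDecidable (a = b)) _ _) _ _ (fun (c : S → Fin n) (i : Fin n) =>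
    (Finset.univ.filter (fun z => c z = i)).map (Function.Embedding.subtype _)) ?_ _ _ ?_ ?_
  · intro c c' h
    funext z
    have := congrFun h (c z)
    have h1 : (z : α) ∈ (Finset.univ.filter (fun y => c y = c z)).map
      (Function.Embedding.subtype (fun x => x ∈ S)) := by simp
    simp only at this
    rw [this] at h1
    simp only [Finset.mem_map, Finset.mem_filter, Finset.mem_univ, true_and,
      Function.Embedding.subtype_apply] at h1
    obtain ⟨y, hy, hyz⟩ := h1
    rw [← hy, Subtype.ext hyz]
  · intro P hP
    rw [if_neg]
    rintro ⟨⟨h1, h2⟩, _⟩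
    apply hP
    have : ∀ z : S, ∃ i, (z : α) ∈ P i := fun z => (h2 z).1 z.2
    choose c hc using this
    refine ⟨c, ?_⟩
    funext i
    ext z
    simp only [Finset.mem_map, Finset.mem_filter, Finset.mem_univ, true_and,
      Function.Embedding.subtype_apply]
    constructor
    · rintro ⟨y, rfl, rfl⟩
      exact hc y
    · intro hz
      have hS := (h2 z).2 ⟨i, hz⟩
      exact ⟨⟨z, hS⟩, h1 z _ _ (hc ⟨z, hS⟩) hz, rfl⟩
  · intro c
    have hpart : IsPart S (fun i => (Finset.univ.filter (fun z => c z = i)).map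
        (Function.Embedding.subtype (fun x => x ∈ S))) := by
      refine ⟨?_, ?_⟩
      · intro z i j
        simp only [Finset.mem_map, Finset.mem_filter, Finset.mem_univ, true_and,
          Function.Embedding.subtype_apply]
        rintro ⟨y, rfl, rfl⟩ ⟨y', rfl, h⟩
        rw [Subtype.ext h]
      · intro z
        simp only [Finset.mem_map, Finset.mem_filter, Finset.mem_univ, true_and,
          Function.Embedding.subtype_apply]
        constructor
        · intro hz
          exact ⟨_, ⟨z, hz⟩, rfl, rfl⟩
        · rintro ⟨_, y, _, rfl⟩
          exact y.2
    simp only [Finset.sum_map, Finset.prod_map, Function.Embedding.subtype_apply]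
    apply if_congr
    · constructor
      · intro h
        refine ⟨hpart, fun i => ?_⟩
        convert h i
      · intro h i
        convert h.2 i
    · rw [← Finset.prod_fiberwise Finset.univ c]
      apply Finset.prod_congr rfl
      intro i _
      apply Finset.prod_congr rfl
      intro z hz
      rw [(Finset.mem_filter.1 hz).2]
    · rfl

/-- algebra generated by the operators of a family -/
def HA {β : Type*} (b : β → G → ℚ) : Subalgebra ℤ (Module.End ℤ (Γ → Finset α → ℚ)) :=
  Algebra.adjoin ℤ (Set.range (fun p : ℕ × β => Hop len vl (p.1 + 1) (b p.2)))

theorem Hop_mem (hlen : ∀ g z, 0 < len g z) {β : Type*} (b : β → G → ℚ) (φ : G → ℚ)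
    (hφ : φ ∈ AddSubgroup.closure (Set.range b)) : ∀ n, Hop len vl n φ ∈ HA len vl b := by
  induction hφ using AddSubgroup.closure_induction with
  | mem x hx =>
    obtain ⟨t, rfl⟩ := hx
    intro n
    cases n with
    | zero => rw [Hop_zero_left len vl hlen]; exact one_mem _
    | succ n => exact Algebra.subset_adjoin ⟨(n, t), rfl⟩
  | zero =>
    intro n
    cases n with
    | zero => rw [Hop_zero_left len vl hlen]; exact one_mem _
    | succ n => rw [Hop_zero_right len vl _ (Nat.succ_ne_zero n)]; exact zero_mem _
  | add x y _ _ hx hy =>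
    intro n
    rw [Hop_add]
    exact sum_mem (fun p _ => mul_mem (hx _) (hy _))
  | neg x _ hx =>
    intro n
    induction n using Nat.strong_induction_on with
    | _ n ih =>
    cases n with
    | zero => rw [Hop_zero_left len vl hlen]; exact one_mem _
    | succ n =>
      have h := Hop_add len vl (n + 1) x (-x)
      rw [add_neg_cancel, Hop_zero_right len vl _ (Nat.succ_ne_zero n),
        Finset.Nat.antidiagonal_succ, Finset.sum_cons, Hop_zero_left len vl hlen, one_mul] at h
      rw [eq_neg_of_add_eq_zero_left h.symm]
      apply neg_mem
      apply sum_mem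
      intro p hp
      refine mul_mem (hx _) (ih _ ?_)
      rw [Finset.mem_map] at hp
      obtain ⟨q, hq, rfl⟩ := hp
      rw [Finset.HasAntidiagonal.mem_antidiagonal] at hq
      simp
      omega

end LP

section FIN
variable {G : Type*} [Group G] [Fintype G] {w : ℕ}

/-- lengths of cycles -/
def lenW (g : Wr G w) (z : Fin w) : ℕ := clen g.2 z

/-- cycle products -/
def vlW (g : Wr G w) (z : Fin w) : G := cycleProd g.1 g.2 z

/-- evaluation of an operator -/
def Emap : Module.End ℤ (Wr G w → Finset (Fin w) → ℚ) →ₗ[ℤ] (Wr G w → ℚ) where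
  toFun op := fun g => op F0 g (basepoints g.2)
  map_add' _ _ := rfl
  map_smul' _ _ := rfl

theorem Emap_ofFn (n : ℕ) (φ : Fin n → G → ℚ) (a : Fin n → ℕ) (g : Wr G w) :
    Emap (List.ofFn (fun i => Hop lenW vlW (a i) (φ i))).prod g =
      zsum φ a (fun z : basepoints g.2 => clen g.2 z)
        (fun z : basepoints g.2 => cycleProd g.1 g.2 z) :=
  ofFn_prod_zsum lenW vlW n φ a g (basepoints g.2)

theorem zetaTuple_hFun {η I : Type*} [Fintype η] [Fintype I] (ws : η → ℕ)
    (h : ∑ i, ws i = w) (φ : η → G → ℚ)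
    (hφ : ∀ i, ∀ x g : G, φ i (x * g * x⁻¹) = φ i g) (κ : ∀ i, Nat.Partition (ws i))
    (p : I → η) (a : I → ℕ)
    (hκ : ∀ i, (Finset.univ.filter (fun k => p k = i)).val.map a = (κ i).parts) (g : Wr G w) :
    zetaTuple ws h φ (fun i => hFun (κ i)) g =
      zsum (fun i => φ (p i)) a (fun z : basepoints g.2 => clen g.2 z)
        (fun z : basepoints g.2 => cycleProd g.1 g.2 z) := by
  rw [zetaTuple_eq ws h φ hφ (fun i => hM (κ i).parts) ?_ (fun i => hFun (κ i)) (fun _ _ => rfl) g _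
    (isTr_basepoints g.2), ← Tval_zsum]
  · apply Finset.sum_congr rfl
    intro c _
    congr 1
    funext i M
    rw [hκ]
    rfl
  · intro i M hM'
    by_contra h0
    apply hM'
    have : Mcount (κ i).parts M ≠ 0 := by
      intro h1
      apply h0
      simp only [hM, h1, Nat.cast_zero]
    rw [Mcount_sum this, (κ i).parts_sum]

theorem monomial_mem {β : Type*} [Fintype β] (b : β → G → ℚ)
    (hb : ∀ i, ∀ x g : G, b i (x * g * x⁻¹) = b i g) (n : ℕ) (a : Fin n → ℕ) (t : Fin n → β)
    (ha : ∀ i, 0 < a i) :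
    Emap (w := w) (List.ofFn (fun i => Hop lenW vlW (a i) (b (t i)))).prod ∈
      Submodule.span ℤ
        (Set.range (fun lam : {l : β → PttAll // ∑ t, (l t).1 = w} => zetaP b lam)) := by
  by_cases hw : ∑ i, a i = w
  · let κ : ∀ s : β, Nat.Partition (∑ i with t i = s, a i) := fun s =>
      { parts := (Finset.univ.filter (fun k => t k = s)).val.map a
        parts_pos := by
          intro i hi
          obtain ⟨k, _, rfl⟩ := Multiset.mem_map.1 hi
          exact ha k
        parts_sum := rfl }
    have hsum : ∑ s, ∑ i with t i = s, a i = w := by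
      rw [← hw]
      exact Finset.sum_fiberwise Finset.univ t a
    have key : Emap (w := w) (List.ofFn (fun i => Hop lenW vlW (a i) (b (t i)))).prod =
        zetaTuple (fun s => ∑ i with t i = s, a i) hsum b (fun s => hFun (κ s)) := by
      funext g
      rw [zetaTuple_hFun _ hsum b hb κ t a (fun s => rfl)]
      exact Emap_ofFn n (fun i => b (t i)) a g
    rw [key]
    refine zetaTuple_mem_of _ hsum b (fun s (mu : Nat.Partition _) => sFun mu) _
      (fun s => hFun_mem (κ s)) _ ?_
    intro μ
    exact Submodule.subset_span ⟨⟨fun s => ⟨_, μ s⟩, hsum⟩, rfl⟩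
  · have key : Emap (w := w) (List.ofFn (fun i => Hop lenW vlW (a i) (b (t i)))).prod = 0 := by
      funext g
      rw [Emap_ofFn n (fun i => b (t i)) a g]
      apply zsum_zero
      rw [(isTr_basepoints g.2).sum_clen, Fintype.card_fin]
      exact fun h => hw h.symm
    rw [key]
    exact zero_mem _

theorem Emap_HA_mem {β : Type*} [Fintype β] (b : β → G → ℚ)
    (hb : ∀ i, ∀ x g : G, b i (x * g * x⁻¹) = b i g)
    (op : Module.End ℤ (Wr G w → Finset (Fin w) → ℚ)) (hop : op ∈ HA lenW vlW b) :
    Emap op ∈ Submodule.span ℤ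
        (Set.range (fun lam : {l : β → PttAll // ∑ t, (l t).1 = w} => zetaP b lam)) := by
  rw [← Submodule.mem_comap]
  have h1 : op ∈ Subalgebra.toSubmodule (HA lenW vlW b) := hop
  rw [HA, Algebra.adjoin_eq_span] at h1
  refine Submodule.span_le.2 ?_ h1
  intro m hm
  obtain ⟨l, hl, rfl⟩ := Submonoid.exists_list_of_mem_closure hm
  have : ∀ i : Fin l.length, ∃ p : ℕ × β,
      Hop (Γ := Wr G w) lenW vlW (p.1 + 1) (b p.2) = l.get i := fun i => hl _ (List.get_mem l i)
  choose p hp using this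
  have h2 : l = List.ofFn (fun i => Hop lenW vlW ((p i).1 + 1) (b (p i).2)) := by
    rw [funext hp, List.ofFn_get]
  rw [h2]
  exact monomial_mem b hb _ (fun i => (p i).1 + 1) (fun i => (p i).2) (fun i => Nat.succ_pos _)

theorem zetaTuple_mem_span {β : Type*} [Fintype β] (b : β → G → ℚ)
    (hb : ∀ i, ∀ x g : G, b i (x * g * x⁻¹) = b i g)
    {η : Type*} [Fintype η] (ws : η → ℕ)
    (h : ∑ i, ws i = w) (φ : η → G → ℚ)
    (hφ : ∀ i, ∀ x g : G, φ i (x * g * x⁻¹) = φ i g)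
    (hφm : ∀ i, φ i ∈ AddSubgroup.closure (Set.range b))
    (fs : ∀ i, Equiv.Perm (Fin (ws i)) → ℚ) (hfs : ∀ i, fs i ∈ VirtCharS (ws i)) :
    zetaTuple ws h φ fs ∈ Submodule.span ℤ
        (Set.range (fun lam : {l : β → PttAll // ∑ t, (l t).1 = w} => zetaP b lam)) := by
  refine zetaTuple_mem_of ws h φ (fun s (mu : Nat.Partition _) => hFun mu) fs
    (fun i => virt_mem (hfs i)) _ ?_
  intro κ
  let e := Fintype.equivFin (Σ i, Fin (Multiset.card (κ i).parts))
  have key : zetaTuple ws h φ (fun i => hFun (κ i)) =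
      Emap (w := w) (List.ofFn (fun k => Hop lenW vlW (LL (κ (e.symm k).1).parts (e.symm k).2)
        (φ (e.symm k).1))).prod := by
    funext g
    rw [zetaTuple_hFun ws h φ hφ κ (fun q : (Σ i, Fin (Multiset.card (κ i).parts)) => q.1)
      (fun q => LL (κ q.1).parts q.2), zsum_reindex e]
    · exact (Emap_ofFn _ (fun k => φ (e.symm k).1)
        (fun k => LL (κ (e.symm k).1).parts (e.symm k).2) g).symm
    · intro i
      rw [filter_sigma_map]
      exact LL_map _
  rw [key]
  apply Emap_HA_mem b hb
  apply list_prod_mem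
  intro x hx
  obtain ⟨k, rfl⟩ := (List.mem_ofFn' _ _).1 hx
  exact Hop_mem lenW vlW (fun g z => clen_pos g.2 z) b _ (hφm _) _

end FIN

/-- **Lemma 3.2.** Let `G` be a finite group, `w ≥ 0`, `𝒳` a finitely generated subgroup of
the abelian group of class functions on `G`, and `B = (b_t)_{t ∈ β}` a `ℤ`-basis of `𝒳`.
Then the class functions `ζ_{λ̲}`, `λ̲ ∈ PMap_w(B)`, form a `ℤ`-basis of `𝒳 ≀ S_w`. -/
theorem zeta_basis_of_wreathSpan (G : Type*) [Group G] [Fintype G] (w : ℕ)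
    (X : AddSubgroup (G → ℚ)) (hXfg : X.FG)
    (hXcf : ∀ f ∈ X, ∀ x g : G, f (x * g * x⁻¹) = f g)
    {β : Type*} [Fintype β] (b : β → (G → ℚ))
    (hb1 : LinearIndependent ℤ b)
    (hb2 : Submodule.span ℤ (Set.range b) = AddSubgroup.toIntSubmodule X) :
    LinearIndependent ℤ
        (fun lam : {l : β → PttAll // ∑ t, (l t).1 = w} => zetaP b lam)
      ∧ Submodule.span ℤ
          (Set.range (fun lam : {l : β → PttAll // ∑ t, (l t).1 = w} => zetaP b lam))
        = AddSubgroup.toIntSubmodule (wreathSpan G w X) := by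
  have hbX : ∀ t, b t ∈ X := by
    intro t
    have : b t ∈ AddSubgroup.toIntSubmodule X := hb2 ▸ Submodule.subset_span ⟨t, rfl⟩
    exact this
  have hbc : ∀ t, ∀ x g : G, b t (x * g * x⁻¹) = b t g := fun t => hXcf _ (hbX t)
  have hXcl : ∀ f ∈ X, f ∈ AddSubgroup.closure (Set.range b) := by
    intro f hf
    have h1 : f ∈ AddSubgroup.toIntSubmodule X := hf
    rw [← hb2] at h1
    have h2 : Submodule.span ℤ (Set.range b) ≤
        AddSubgroup.toIntSubmodule (AddSubgroup.closure (Set.range b)) :=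
      Submodule.span_le.2 AddSubgroup.subset_closure
    exact h2 h1
  refine ⟨zetaP_indep b hbc hb1 w, le_antisymm ?_ ?_⟩
  · rw [Submodule.span_le]
    rintro _ ⟨lam, rfl⟩
    exact zetaP_mem X w hXcf b hbX lam
  · intro ξ hξ
    have h1 : ξ ∈ wreathSpan G w X := hξ
    have h2 : wreathSpan G w X ≤ (Submodule.span ℤ
        (Set.range (fun lam : {l : β → PttAll // ∑ t, (l t).1 = w} =>
          zetaP b lam))).toAddSubgroup := by
      unfold wreathSpan
      rw [AddSubgroup.closure_le]
      rintro _ ⟨n, ws, h, φs, fs, hφ, hfs, rfl⟩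
      exact zetaTuple_mem_span b hbc ws h φs (fun i => hXcf _ (hφ i))
        (fun i => hXcl _ (hφ i)) fs hfs
    exact h2 h1

end
end

section
/- Let G be a finite group, φ, ψ ∈ CF(G), and λ, μ ∈ Par(w). Then ⟨ζ_{(φ,p_λ)}, ζ_{(ψ, p̃_μ)}⟩ = δ_{λμ} ⟨φ, ψ⟩^{l(λ)}, where ⟨·,·⟩ on the left is the scalar product of class functions on G≀S_w. -/
open scoped BigOperators
open Classical

noncomputable section

/-- The class function `p_λ` on `S_w`: `p_λ(g_μ) = z_λ δ_{λμ}`. -/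
def pFun {w : ℕ} (lam : Nat.Partition w) : Equiv.Perm (Fin w) → ℚ :=
  fun g => if cycM g = lam.parts then (zMult lam.parts : ℚ) else 0

/-- The class function `p̃_λ = z_λ⁻¹ p_λ` on `S_w`: the indicator of the class of type `λ`. -/
def ptFun {w : ℕ} (lam : Nat.Partition w) : Equiv.Perm (Fin w) → ℚ :=
  fun g => if cycM g = lam.parts then 1 else 0

theorem zp_parts {w : ℕ} (lam : Nat.Partition w) :
    lam.parts = lam.parts.filter (2 ≤ ·) +
      Multiset.replicate (w - (lam.parts.filter (2 ≤ ·)).sum) 1 := by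
  have h1 : lam.parts.filter (fun a => ¬ 2 ≤ a) =
      Multiset.replicate (Multiset.card (lam.parts.filter (fun a => ¬ 2 ≤ a))) 1 := by
    rw [Multiset.eq_replicate_card]
    intro b hb
    rw [Multiset.mem_filter] at hb
    have := lam.parts_pos hb.1
    omega
  have h2 := Multiset.filter_add_not (2 ≤ ·) lam.parts
  have h3 := congrArg Multiset.sum h2
  rw [Multiset.sum_add, lam.parts_sum, h1] at h3
  simp only [Multiset.sum_replicate, smul_eq_mul, mul_one] at h3
  have h4 : w - (lam.parts.filter (2 ≤ ·)).sum =
      Multiset.card (lam.parts.filter (fun a => ¬ 2 ≤ a)) := by omega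
  rw [h4, ← h1, h2]

theorem zp_cycM_iff {w : ℕ} (lam : Nat.Partition w) (g : Equiv.Perm (Fin w)) :
    cycM g = lam.parts ↔ g.cycleType = lam.parts.filter (2 ≤ ·) := by
  constructor
  · intro h
    rw [← h, cycM, Multiset.filter_add]
    have h1 : g.cycleType.filter (2 ≤ ·) = g.cycleType :=
      Multiset.filter_eq_self.2 fun a ha => Equiv.Perm.two_le_of_mem_cycleType ha
    have h2 : (Multiset.replicate (w - g.support.card) 1).filter (2 ≤ ·) = 0 := by
      rw [Multiset.filter_eq_nil]
      intro a ha
      rw [Multiset.eq_of_mem_replicate ha]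
      omega
    rw [h1, h2, add_zero]
  · intro h
    rw [zp_parts lam, ← h, cycM, Equiv.Perm.sum_cycleType]

theorem zp_zMult {w : ℕ} (lam : Nat.Partition w) :
    zMult lam.parts = (w - (lam.parts.filter (2 ≤ ·)).sum).factorial *
      (lam.parts.filter (2 ≤ ·)).prod *
      ∏ n ∈ (lam.parts.filter (2 ≤ ·)).toFinset,
        ((lam.parts.filter (2 ≤ ·)).count n).factorial := by
  have hp := zp_parts lam
  have hm : ∀ a ∈ lam.parts.filter (2 ≤ ·), 2 ≤ a := fun a ha => (Multiset.mem_filter.1 ha).2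
  generalize lam.parts.filter (2 ≤ ·) = m at hp hm ⊢
  generalize w - m.sum = k at hp ⊢
  rw [hp]
  have h1 : (1 : ℕ) ∉ m.toFinset := by
    intro h
    have := hm 1 (Multiset.mem_toFinset.1 h)
    omega
  have hc : m.count 1 = 0 := by
    rw [Multiset.count_eq_zero]
    simpa using h1
  have : zMult (m + Multiset.replicate k 1) = ∏ i ∈ insert 1 m.toFinset,
      i ^ (m + Multiset.replicate k 1).count i *
        ((m + Multiset.replicate k 1).count i).factorial := by
    unfold zMult
    apply Finset.prod_subset
    · intro a ha
      rw [Multiset.mem_toFinset, Multiset.mem_add] at ha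
      rw [Finset.mem_insert, Multiset.mem_toFinset]
      rcases ha with ha | ha
      · exact Or.inr ha
      · exact Or.inl (Multiset.eq_of_mem_replicate ha)
    · intro a _ ha
      rw [Multiset.mem_toFinset] at ha
      rw [Multiset.count_eq_zero_of_notMem ha]
      simp
  rw [this, Finset.prod_insert h1, Finset.prod_multiset_count,
    mul_assoc k.factorial, ← Finset.prod_mul_distrib]
  congr 1
  · simp [hc]
  · apply Finset.prod_congr rfl
    intro a ha
    have ha1 : a ≠ 1 := fun h => h1 (h ▸ ha)
    simp [Multiset.count_add, Multiset.count_replicate, ha1.symm]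

theorem zp_card {w : ℕ} (lam : Nat.Partition w) :
    (Finset.univ.filter (fun g : Equiv.Perm (Fin w) => cycM g = lam.parts)).card *
      zMult lam.parts = w.factorial := by
  have h := Equiv.Perm.card_of_cycleType_mul_eq (Fin w) (lam.parts.filter (2 ≤ ·))
  rw [Fintype.card_fin, ← zp_zMult, if_pos] at h
  · rw [← h]
    congr 2
    ext g
    simp only [Finset.mem_filter, Finset.mem_univ, true_and]
    exact zp_cycM_iff lam g
  · refine ⟨?_, fun a ha => (Multiset.mem_filter.1 ha).2⟩
    have h3 := congrArg Multiset.sum (Multiset.filter_add_not (2 ≤ ·) lam.parts)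
    rw [Multiset.sum_add, lam.parts_sum] at h3
    omega

theorem zp_cycM_inv {w : ℕ} (g : Equiv.Perm (Fin w)) : cycM g⁻¹ = cycM g := by
  simp [cycM]

theorem zp_basepoints_inv {w : ℕ} (g : Equiv.Perm (Fin w)) :
    basepoints g⁻¹ = basepoints g := by
  simp [basepoints]

theorem zp_isCycleOn {w : ℕ} (σ : Equiv.Perm (Fin w)) (i : Fin w) :
    σ.IsCycleOn ((Finset.univ.filter (fun j => σ.SameCycle i j) : Finset (Fin w)) :
      Set (Fin w)) := by
  refine ⟨⟨?_, σ.injective.injOn, ?_⟩, ?_⟩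
  · intro j hj
    simp only [Finset.coe_filter, Finset.mem_univ, true_and, Set.mem_ofPred_eq] at hj ⊢
    exact Equiv.Perm.sameCycle_apply_right.2 hj
  · intro j hj
    simp only [Finset.coe_filter, Finset.mem_univ, true_and, Set.mem_ofPred_eq] at hj
    refine ⟨σ⁻¹ j, ?_, by simp⟩
    simp only [Finset.coe_filter, Finset.mem_univ, true_and, Set.mem_ofPred_eq]
    exact hj.trans ⟨-1, by simp⟩
  · intro j hj k hk
    simp only [Finset.coe_filter, Finset.mem_univ, true_and, Set.mem_ofPred_eq] at hj hk
    exact hj.symm.trans hk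

theorem zp_cycleProd_inv {G : Type*} [Group G] {w : ℕ} (x : Fin w → G)
    (σ : Equiv.Perm (Fin w)) (i : Fin w) :
    cycleProd (fun j => (x (σ j))⁻¹) σ⁻¹ i = (cycleProd x σ i)⁻¹ := by
  unfold cycleProd
  have hc : ∀ d : DecidablePred (fun j => σ⁻¹.SameCycle i j),
      (@Finset.filter _ (fun j => σ⁻¹.SameCycle i j) d Finset.univ) =
      Finset.univ.filter (fun j => σ.SameCycle i j) := by
    intro d
    ext j
    simp
  rw [hc]
  have hn := (zp_isCycleOn σ i).pow_card_apply (a := i)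
          (by simp [Equiv.Perm.SameCycle.refl])
  generalize (Finset.univ.filter (fun j => σ.SameCycle i j)).card = n at hn
  rw [List.prod_inv_reverse]
  congr 1
  apply List.ext_getElem
  · simp
  · intro k h1 h2
    simp only [List.length_map, List.length_range] at h1
    simp only [List.getElem_map, List.getElem_range, List.getElem_reverse, List.length_map,
      List.length_range, inv_inv]
    congr 2
    rw [inv_pow, Equiv.Perm.eq_inv_iff_eq]
    rw [← Equiv.Perm.mul_apply, ← Equiv.Perm.mul_apply, ← pow_succ, ← pow_add]
    rw [show n - 1 - k + 1 + k = n by omega, hn]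

theorem zp_sum {G : Type*} [Group G] [Fintype G] {w : ℕ} (σ : Equiv.Perm (Fin w))
    (F : G → ℚ) :
    ∑ x : Fin w → G, ∏ i ∈ basepoints σ, F (cycleProd x σ i) =
      (∑ g, F g) ^ (basepoints σ).card * (Fintype.card G : ℚ) ^ (w - (basepoints σ).card) := by
  let e : (Fin w → G) → (Fin w → G) := fun x i =>
    if i ∈ basepoints σ then cycleProd x σ i else x i
  have he : Function.Injective e := by
    intro x y hxy
    have hnb : ∀ i, i ∉ basepoints σ → x i = y i := by
      intro i hi
      have := congrFun hxy i
      simpa [e, hi] using this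
    funext i
    by_cases hi : i ∈ basepoints σ
    · have h := congrFun hxy i
      simp only [e, hi, if_true] at h
      unfold cycleProd at h
      have hpos : 0 < (Finset.univ.filter (fun j => σ.SameCycle i j)).card :=
        Finset.card_pos.2 ⟨i, by simp [Equiv.Perm.SameCycle.refl]⟩
      have hcyc := fun n : ℕ => (Equiv.Perm.isCycleOn_inv.2 (zp_isCycleOn σ i)).pow_apply_eq (a := i) (n := n)
          (by simp [Equiv.Perm.SameCycle.refl])
      generalize (Finset.univ.filter (fun j => σ.SameCycle i j)).card = n at h hpos hcyc
      obtain ⟨m, rfl⟩ : ∃ m, n = m + 1 := ⟨n - 1, by omega⟩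
      rw [List.range_succ_eq_map] at h
      simp only [List.map_cons, List.prod_cons, List.map_map, pow_zero,
        Equiv.Perm.one_apply] at h
      have hr : List.map ((fun k => x ((σ⁻¹ ^ k) i)) ∘ Nat.succ) (List.range m) =
          List.map ((fun k => y ((σ⁻¹ ^ k) i)) ∘ Nat.succ) (List.range m) := by
        apply List.map_congr_left
        intro k hk
        rw [List.mem_range] at hk
        apply hnb
        intro hb
        have hs : σ.SameCycle i ((σ⁻¹ ^ (k + 1)) i) := by
          refine ⟨-((k + 1 : ℕ) : ℤ), ?_⟩
          rw [zpow_neg, zpow_natCast, inv_pow]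
        have h1 := (Finset.mem_filter.1 hi).2 _ hs
        have h2 := (Finset.mem_filter.1 hb).2 _ hs.symm
        have h3 := (hcyc (k + 1)).1 (le_antisymm h2 h1)
        have := Nat.le_of_dvd (by omega) h3
        omega
      rw [hr] at h
      exact mul_right_cancel h
    · exact hnb i hi
  have hb : Function.Bijective e := Finite.injective_iff_bijective.1 he
  have h1 : ∀ x : Fin w → G, ∏ i ∈ basepoints σ, F (cycleProd x σ i) =
      ∏ i, (if i ∈ basepoints σ then F (e x i) else 1) := by
    intro x
    rw [Finset.prod_ite_mem, Finset.univ_inter]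
    apply Finset.prod_congr rfl
    intro i hi
    simp [e, hi]
  simp_rw [h1]
  rw [hb.sum_comp (fun y : Fin w → G => ∏ i, (if i ∈ basepoints σ then F (y i) else 1))]
  rw [← Fintype.prod_sum (fun (i : Fin w) (g : G) => if i ∈ basepoints σ then F g else 1)]
  have h2 : ∀ i : Fin w, (∑ g : G, if i ∈ basepoints σ then F g else 1) =
      if i ∈ basepoints σ then ∑ g, F g else (Fintype.card G : ℚ) := by
    intro i
    split_ifs <;> simp
  simp_rw [h2]
  rw [Finset.prod_ite, Finset.prod_const, Finset.prod_const]
  congr 2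
  · simp
  · rw [Finset.filter_not, Finset.card_sdiff]
    simp

theorem zp_card_basepoints {w : ℕ} (σ : Equiv.Perm (Fin w)) :
    (basepoints σ).card = Multiset.card (cycM σ) := by
  rw [cycM, Multiset.card_add, Multiset.card_replicate, Equiv.Perm.cycleType_def,
    Multiset.card_map, Finset.card_val]
  rw [← Finset.card_filter_add_card_filter_not (s := basepoints σ) (fun i => i ∈ σ.support)]
  congr 1
  · apply Finset.card_bij (fun i _ => σ.cycleOf i)
    · intro i hi
      exact Equiv.Perm.cycleOf_mem_cycleFactorsFinset_iff.2 (Finset.mem_filter.1 hi).2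
    · intro i hi j hj hij
      have hi' := Finset.mem_filter.1 hi
      have hj' := Finset.mem_filter.1 hj
      have hs : σ.SameCycle i j := by
        have : j ∈ (σ.cycleOf i).support := by
          rw [hij, Equiv.Perm.mem_support_cycleOf_iff]
          exact ⟨Equiv.Perm.SameCycle.rfl, hj'.2⟩
        exact (Equiv.Perm.mem_support_cycleOf_iff.1 this).1
      exact le_antisymm ((Finset.mem_filter.1 hi'.1).2 _ hs)
        ((Finset.mem_filter.1 hj'.1).2 _ hs.symm)
    · intro c hc
      have hne : c.support.Nonempty :=
        (Equiv.Perm.mem_cycleFactorsFinset_iff.1 hc).1.nonempty_support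
      have hmem := Finset.min'_mem _ hne
      have hco := Equiv.Perm.cycle_is_cycleOf hmem hc
      refine ⟨c.support.min' hne, ?_, hco.symm⟩
      have hsup := Equiv.Perm.mem_cycleFactorsFinset_support_le hc hmem
      rw [Finset.mem_filter]
      refine ⟨Finset.mem_filter.2 ⟨Finset.mem_univ _, fun j hj => ?_⟩, hsup⟩
      apply Finset.min'_le
      rw [hco, Equiv.Perm.mem_support_cycleOf_iff]
      exact ⟨hj, hsup⟩
  · have : (basepoints σ).filter (fun i => i ∉ σ.support) = σ.supportᶜ := by
      ext i
      simp only [Finset.mem_filter, Finset.mem_compl, and_iff_right_iff_imp]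
      intro hi
      refine Finset.mem_filter.2 ⟨Finset.mem_univ _, fun j hj => ?_⟩
      rw [Equiv.Perm.notMem_support] at hi
      obtain ⟨k, rfl⟩ := hj
      rw [Equiv.Perm.zpow_apply_eq_self_of_apply_eq_self hi]
    rw [this, Finset.card_compl, Fintype.card_fin]

/-- **Lemma 3.5.** Let `G` be a finite group, `φ, ψ ∈ CF(G)` and `λ, μ ∈ Par(w)`. Then
`⟨ζ_{(φ, p_λ)}, ζ_{(ψ, p̃_μ)}⟩ = δ_{λμ} ⟨φ, ψ⟩^{l(λ)}`, where
`ζ_{(φ, f)} = φ^{∼⊗w} · Inf_{S_w}^{G≀S_w} f`. -/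
theorem zeta_pairing {G : Type*} [Group G] [Fintype G] {w : ℕ} (φ ψ : G → ℚ)
    (hφ : ∀ x g : G, φ (x * g * x⁻¹) = φ g) (hψ : ∀ x g : G, ψ (x * g * x⁻¹) = ψ g)
    (lam mu : Nat.Partition w) :
    sp (fun g : Wr G w => tilprod φ g * pFun lam g.2)
       (fun g : Wr G w => tilprod ψ g * ptFun mu g.2)
      = (if lam = mu then 1 else 0) * (sp φ ψ) ^ (Multiset.card lam.parts) := by
  have hcw : Multiset.card lam.parts ≤ w := by
    have := Multiset.card_nsmul_le_sum (s := lam.parts) (a := 1) (fun x hx => lam.parts_pos hx)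
    rw [lam.parts_sum] at this
    simpa using this
  have hG : (Fintype.card G : ℚ) ≠ 0 := by
    exact_mod_cast Fintype.card_ne_zero
  have hW : (Fintype.card (Wr G w) : ℚ) = (Fintype.card G : ℚ) ^ w * (w.factorial : ℚ) := by
    have : Fintype.card (Wr G w) = Fintype.card ((Fin w → G) × Equiv.Perm (Fin w)) := rfl
    rw [this, Fintype.card_prod, Fintype.card_perm]
    simp
  have key : ∀ σ : Equiv.Perm (Fin w), ∑ x : Fin w → G,
      (tilprod φ ((x, σ) : Wr G w) * pFun lam σ) *
        (tilprod ψ ((x, σ) : Wr G w)⁻¹ * ptFun mu σ⁻¹) =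
      if cycM σ = lam.parts then (if lam = mu then 1 else 0) * (zMult lam.parts : ℚ) *
        ((∑ g, φ g * ψ g⁻¹) ^ (Multiset.card lam.parts) *
          (Fintype.card G : ℚ) ^ (w - Multiset.card lam.parts)) else 0 := by
    intro σ
    split_ifs with h1 h2
    · subst h2
      rw [← h1, ← zp_card_basepoints, ← zp_sum, one_mul, Finset.mul_sum]
      apply Finset.sum_congr rfl
      intro x _
      rw [pFun, ptFun, zp_cycM_inv, if_pos h1, if_pos h1, h1]
      have : tilprod ψ ((x, σ) : Wr G w)⁻¹ =
          ∏ i ∈ basepoints σ, ψ (cycleProd x σ i)⁻¹ := by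
        show ∏ i ∈ basepoints σ⁻¹, ψ (cycleProd (fun j => (x (σ j))⁻¹) σ⁻¹ i) = _
        rw [zp_basepoints_inv]
        simp_rw [zp_cycleProd_inv]
      rw [this, Finset.prod_mul_distrib]
      simp only [tilprod]
      ring
    · have h3 : cycM σ ≠ mu.parts := fun h => h2 (Nat.Partition.ext (h1.symm.trans h))
      simp [ptFun, zp_cycM_inv, h3]
    · simp [pFun, h1]
  have hsum : (∑ g : Wr G w, (tilprod φ g * pFun lam g.2) *
      (tilprod ψ g⁻¹ * ptFun mu (g⁻¹).2)) = ∑ σ : Equiv.Perm (Fin w), ∑ x : Fin w → G,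
      (tilprod φ ((x, σ) : Wr G w) * pFun lam σ) *
        (tilprod ψ ((x, σ) : Wr G w)⁻¹ * ptFun mu σ⁻¹) :=
    Fintype.sum_prod_type_right (α₁ := Fin w → G) (α₂ := Equiv.Perm (Fin w))
      (fun g => (tilprod φ (g : Wr G w) * pFun lam g.2) *
        (tilprod ψ (g : Wr G w)⁻¹ * ptFun mu g.2⁻¹))
  have hz : ((Finset.univ.filter (fun g : Equiv.Perm (Fin w) => cycM g = lam.parts)).card : ℚ) *
      (zMult lam.parts : ℚ) = (w.factorial : ℚ) := by exact_mod_cast zp_card lam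
  have hw : (w.factorial : ℚ) ≠ 0 := by exact_mod_cast Nat.factorial_ne_zero w
  unfold sp
  rw [hsum]
  simp_rw [key]
  rw [← Finset.sum_filter, Finset.sum_const, nsmul_eq_mul, hW, mul_pow, inv_pow]
  rw [← hz] at hw ⊢
  have hp : (Fintype.card G : ℚ) ^ w = (Fintype.card G : ℚ) ^ (Multiset.card lam.parts) *
      (Fintype.card G : ℚ) ^ (w - Multiset.card lam.parts) := by
    rw [← pow_add]; congr 1; omega
  rw [hp]
  have hc := left_ne_zero_of_mul hw
  have hz' := right_ne_zero_of_mul hw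
  field_simp

end
end
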